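/- Let N ≥ 2, let X ⊆ ℂ^N be a connected open set, let M₁ < M₂ < M₃ be real numbers, and let ρ : X → ℝ be a C^∞ exhaustion function whose Levi form has at least two positive eigenvalues at every point of {x ∈ X : ρ(x) > M₁}. Let D ⊂ ℂ be a bounded connected smoothly bounded domain, P ⊆ ℂ^n an open set containing 0, and let f : D̄ × P → X be a spray of maps of class A²(D) with finite exceptional set σ ⊂ D of order k. Assume U ⊆ D is open with compact closure in D such that M₁ < ρ(f₀(z)) < M₂ for all z ∈ D̄ ∖ U, where f₀ = f(·,0). Then for every ε > 0 there exist an open set P' ⊆ P containing 0 and a spray of maps g : D̄ × P' → X of class A²(D) with exceptional set σ of order k such that: (i) M₂ < ρ(g₀(z)) < M₃ for all z ∈ ∂D; (ii) ρ(g₀(z)) > M₁ for all z ∈ D̄ ∖ U; (iii) ‖g₀(z) − f₀(z)‖ < ε for all z ∈ Ū; (iv) f₀ and g₀ agree to order k at every point of σ; moreover g₀ is homotopic to f₀ through continuous maps D̄ → X. -/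

import Mathlib

open Set Filter Complex Metric

noncomputable section

abbrev Cn (N : ℕ) := EuclideanSpace ℂ (Fin N)

def LeviForm {N : ℕ} (ρ : Cn N → ℝ) (x v : Cn N) : ℝ :=
  (1 / 4) * (iteratedFDeriv ℝ 2 ρ x ![v, v] +
    iteratedFDeriv ℝ 2 ρ x ![Complex.I • v, Complex.I • v])

def TwoPosEigen {N : ℕ} (ρ : Cn N → ℝ) (x : Cn N) : Prop :=
  ∃ W : Submodule ℂ (Cn N), Module.finrank ℂ W = 2 ∧
    ∀ v ∈ W, v ≠ 0 → 0 < LeviForm ρ x v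

def SmoothlyBounded (D : Set ℂ) : Prop :=
  ∃ V : Set ℂ, IsOpen V ∧ frontier D ⊆ V ∧
    ∃ v : ℂ → ℝ, ContDiffOn ℝ (⊤ : ℕ∞) v V ∧
      D ∩ V = {z ∈ V | v z < 0} ∧
      frontier D = {z ∈ V | v z = 0} ∧
      ∀ z ∈ frontier D, fderiv ℝ v z ≠ 0

/-- `f` and `g` are homotopic through continuous maps `S → X`. -/
def HomotopicIn {N : ℕ} (X : Set (Cn N)) (S : Set ℂ) (f g : ℂ → Cn N) : Prop :=
  ∃ H : ℝ × ℂ → Cn N, ContinuousOn H (Icc (0:ℝ) 1 ×ˢ S) ∧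
    (∀ s ∈ Icc (0:ℝ) 1, ∀ z ∈ S, H (s, z) ∈ X) ∧
    (∀ z ∈ S, H (0, z) = f z) ∧ (∀ z ∈ S, H (1, z) = g z)

/-- A spray of maps `D̄ × P → X` of class `A²(D)` with exceptional (finite) set
`σ ⊆ D` of order `k`: continuous on `D̄ × P` together with its partial
derivatives of order `≤ 2` in `z`, holomorphic in the interior, `f(·,t)` agrees
with the core `f(·,0)` to order `k` on `σ`, and the `t`-differential is
surjective away from `σ`. -/
def SprayA2 {N n : ℕ} (X : Set (Cn N)) (D : Set ℂ) (P : Set (Cn n)) (σ : Set ℂ) (k : ℕ)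
    (f : ℂ × Cn n → Cn N) : Prop :=
  (∀ p ∈ closure D ×ˢ P, f p ∈ X) ∧
  ContinuousOn f (closure D ×ˢ P) ∧
  DifferentiableOn ℂ f (D ×ˢ P) ∧
  (∀ i ≤ 2, ∃ g : ℂ × Cn n → Cn N, ContinuousOn g (closure D ×ˢ P) ∧
    EqOn g (fun p => iteratedDeriv i (fun w => f (w, p.2)) p.1) (D ×ˢ P)) ∧
  (∀ t ∈ P, ∀ z ∈ σ, ∀ j ≤ k,
    iteratedDeriv j (fun w => f (w, t)) z = iteratedDeriv j (fun w => f (w, 0)) z) ∧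
  (∀ z ∈ closure D \ σ, ∀ t ∈ P,
    Function.Surjective (fderiv ℂ (fun t' => f (z, t')) t))

lemma smul_decomp {N : ℕ} (l : ℂ) (v : Cn N) :
    l • v = (l.re : ℝ) • v + (l.im : ℝ) • (Complex.I • v) := by
  ext i
  simp only [PiLp.smul_apply, PiLp.add_apply, smul_eq_mul, Complex.real_smul]
  conv_lhs => rw [← Complex.re_add_im l]
  ring

/-- The complex bilinear part of a real bilinear form. -/
def BC {N : ℕ} (H : Cn N →L[ℝ] Cn N →L[ℝ] ℝ) (x y : Cn N) : ℂ :=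
  ⟨(H x y - H (Complex.I • x) (Complex.I • y)) / 2,
    -(H x (Complex.I • y) + H (Complex.I • x) y) / 2⟩

lemma I_I_smul {N : ℕ} (v : Cn N) : Complex.I • Complex.I • v = -v := by
  rw [smul_smul, Complex.I_mul_I, neg_one_smul]

lemma BC_expand {N : ℕ} (H : Cn N →L[ℝ] Cn N →L[ℝ] ℝ) (hs : ∀ x y, H x y = H y x)
    (x y : Cn N) (c : ℂ) :
    BC H (x + c • y) (x + c • y) = BC H x x + 2 * c * BC H x y + c ^ 2 * BC H y y := by
  have e1 : c • y = (c.re : ℝ) • y + (c.im : ℝ) • (Complex.I • y) := smul_decomp c y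
  have e2 : Complex.I • (x + c • y) = Complex.I • x + ((c.re : ℝ) • (Complex.I • y) - (c.im : ℝ) • y) := by
    rw [e1, smul_add, smul_add, smul_comm Complex.I (c.re : ℝ), smul_comm Complex.I (c.im : ℝ),
      I_I_smul]
    simp [sub_eq_add_neg]
  apply Complex.ext
  · simp only [BC, e2]
    simp only [e1, map_add, map_sub, map_smul, _root_.add_apply, _root_.sub_apply,
      _root_.smul_apply, smul_eq_mul, Complex.add_re, Complex.mul_re, Complex.mul_im, pow_two,
      Complex.add_im]
    simp only [hs (Complex.I • y) x, hs y x, hs (Complex.I • y) y, hs (Complex.I • x) x,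
      hs (Complex.I • x) y, hs (Complex.I • y) (Complex.I • x)]
    norm_num
    ring
  · simp only [BC, e2]
    simp only [e1, map_add, map_sub, map_smul, _root_.add_apply, _root_.sub_apply,
      _root_.smul_apply, smul_eq_mul, Complex.add_re, Complex.mul_re, Complex.mul_im, pow_two,
      Complex.add_im]
    simp only [hs (Complex.I • y) x, hs y x, hs (Complex.I • y) y, hs (Complex.I • x) x,
      hs (Complex.I • x) y, hs (Complex.I • y) (Complex.I • x)]
    norm_num
    ring

lemma H_expand {N : ℕ} (H : Cn N →L[ℝ] Cn N →L[ℝ] ℝ) (hs : ∀ x y, H x y = H y x)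
    (v : Cn N) (l : ℂ) :
    H (l • v) (l • v) = ‖l‖ ^ 2 * ((H v v + H (Complex.I • v) (Complex.I • v)) / 2)
      + (l ^ 2 * BC H v v).re := by
  rw [smul_decomp l v, Complex.sq_norm, Complex.normSq_apply]
  simp only [BC, map_add, map_smul, _root_.add_apply,
      _root_.smul_apply, smul_eq_mul, Complex.mul_re, Complex.mul_im, pow_two]
  simp only [hs (Complex.I • v) v]
  ring

lemma A_expand {N : ℕ} (A : Cn N →L[ℝ] ℝ) (v : Cn N) (l : ℂ) :
    A (l • v) = (l * (⟨A v, -A (Complex.I • v)⟩ : ℂ)).re := by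
  rw [smul_decomp l v]
  simp only [map_add, map_smul, smul_eq_mul, Complex.mul_re]
  ring

lemma exists_dir {N : ℕ} (H : Cn N →L[ℝ] Cn N →L[ℝ] ℝ) (hs : ∀ x y, H x y = H y x)
    (A : Cn N →L[ℝ] ℝ) (W : Submodule ℂ (Cn N)) (hW : Module.finrank ℂ W = 2)
    (hpos : ∀ v ∈ W, v ≠ 0 → 0 < H v v + H (Complex.I • v) (Complex.I • v)) :
    ∃ v w : Cn N, ∃ c > 0, (∀ l : ℂ, A (l • v) = 0) ∧
      ∀ l : ℂ, c * ‖l‖ ^ 2 ≤ H (l • v) (l • v) + A ((2 * l ^ 2) • w) := by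
  have hfin : Module.Finite ℂ W := Module.finite_of_finrank_pos (by omega)
  let b := Module.finBasisOfFinrankEq ℂ W hW
  have hb := b.linearIndependent
  have hcomb : ∀ c d : ℂ, (c ≠ 0 ∨ d ≠ 0) → (c • (b 0 : Cn N) + d • (b 1 : Cn N)) ≠ 0 := by
    intro c d hcd h0
    have h := (Fintype.linearIndependent_iff.1 hb) ![c, d] (by
      rw [Fin.sum_univ_two]
      apply Subtype.ext
      simpa using h0)
    have h1 := h 0
    have h2 := h 1
    simp at h1 h2
    tauto
  have hmem : ∀ c d : ℂ, (c • (b 0 : Cn N) + d • (b 1 : Cn N)) ∈ W := fun c d =>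
    W.add_mem (W.smul_mem _ (b 0).2) (W.smul_mem _ (b 1).2)
  by_cases hA : A = 0
  · obtain ⟨v, hvW, hv0, hv⟩ : ∃ v ∈ W, v ≠ 0 ∧ BC H v v = 0 := by
      by_cases h2 : BC H (b 1 : Cn N) (b 1) = 0
      · refine ⟨b 1, (b 1).2, ?_, h2⟩
        have := hcomb 0 1 (by simp)
        simpa using this
      · obtain ⟨s, hs2⟩ : ∃ s : ℂ, s ^ 2 = discrim (BC H (b 1 : Cn N) (b 1)) (2 * BC H (b 0 : Cn N) (b 1)) (BC H (b 0 : Cn N) (b 0)) :=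
          IsAlgClosed.exists_pow_nat_eq _ (by norm_num)
        have := exists_quadratic_eq_zero h2 ⟨s, by rw [← hs2, pow_two]⟩
        obtain ⟨c, hc⟩ := this
        refine ⟨(b 0 : Cn N) + c • (b 1 : Cn N), by simpa using hmem 1 c, by simpa using hcomb 1 c (by simp), ?_⟩
        rw [BC_expand H hs]
        linear_combination hc
    refine ⟨v, 0, _, half_pos (hpos v hvW hv0), by simp [hA], fun l => ?_⟩
    rw [H_expand H hs v l, hv]
    simp [hA]
    linarith
  · obtain ⟨w0, hw0⟩ : ∃ w, A w ≠ 0 := by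
      by_contra h
      push Not at h
      exact hA (ContinuousLinearMap.ext h)
    let F : Cn N → ℂ := fun v => ⟨A v, -A (Complex.I • v)⟩
    have hFsmul : ∀ (c : ℂ) v, F (c • v) = c * F v := by
      intro c v
      apply Complex.ext
      · exact A_expand A v c
      · change -A (Complex.I • c • v) = _
        rw [smul_smul, A_expand]
        simp [F]
    have hFadd : ∀ v w, F (v + w) = F v + F w := by
      intro v w
      apply Complex.ext <;> simp [F] ; ring
    have hF0 : F w0 ≠ 0 := by
      intro h
      exact hw0 (congrArg Complex.re h)
    obtain ⟨v, hvW, hv0, hv⟩ : ∃ v ∈ W, v ≠ 0 ∧ F v = 0 := by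
      by_cases h2 : F (b 1 : Cn N) = 0
      · refine ⟨b 1, (b 1).2, ?_, h2⟩
        have := hcomb 0 1 (by simp)
        simpa using this
      · refine ⟨_, hmem (F (b 1 : Cn N)) (-F (b 0 : Cn N)), hcomb _ _ (Or.inl h2), ?_⟩
        rw [hFadd, hFsmul, hFsmul]
        ring
    refine ⟨v, (-(BC H v v) / (2 * F w0)) • w0, _, half_pos (hpos v hvW hv0), fun l => ?_, fun l => ?_⟩
    · rw [A_expand]
      change (l * F v).re = 0
      simp [hv]
    · rw [smul_smul, A_expand A w0, H_expand H hs v l]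
      change _ ≤ _ + (_ * F w0).re
      have : (2 * l ^ 2 * (-(BC H v v) / (2 * F w0)) * F w0) = - (l ^ 2 * BC H v v) := by
        field_simp
      rw [this, Complex.neg_re]
      linarith

lemma mono_aux (G G1 : ℝ → ℝ) (h1 : ∀ s ∈ Icc (0:ℝ) 1, HasDerivAt G (G1 s) s)
    (h : ∀ s ∈ Icc (0:ℝ) 1, 0 ≤ G1 s) : ∀ s ∈ Icc (0:ℝ) 1, G 0 ≤ G s := by
  intro s hs
  have : MonotoneOn G (Icc (0:ℝ) 1) := by
    apply monotoneOn_of_deriv_nonneg (convex_Icc 0 1)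
    · exact fun x hx => (h1 x hx).continuousAt.continuousWithinAt
    · intro x hx
      rw [interior_Icc] at hx
      exact (h1 x (Ioo_subset_Icc_self hx)).differentiableAt.differentiableWithinAt
    · intro x hx
      rw [interior_Icc] at hx
      rw [(h1 x (Ioo_subset_Icc_self hx)).deriv]
      exact h x (Ioo_subset_Icc_self hx)
  exact this (by simp) hs hs.1

lemma taylor2 (G G1 G2 : ℝ → ℝ) (m : ℝ) (h1 : ∀ s ∈ Icc (0:ℝ) 1, HasDerivAt G (G1 s) s)
    (h2 : ∀ s ∈ Icc (0:ℝ) 1, HasDerivAt G1 (G2 s) s)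
    (hm : ∀ s ∈ Icc (0:ℝ) 1, m ≤ G2 s) : G 0 + G1 0 + m / 2 ≤ G 1 := by
  have k1 : ∀ s ∈ Icc (0:ℝ) 1, G1 0 ≤ G1 s - m * s := by
    intro s hs
    have := mono_aux (fun s => G1 s - m * s) (fun s => G2 s - m * 1)
      (fun s hs => (h2 s hs).sub ((hasDerivAt_id s).const_mul m)) (fun s hs => by
        have := hm s hs; simp; linarith) s hs
    simpa using this
  have := mono_aux (fun s => G s - G1 0 * s - m / 2 * s ^ 2)
    (fun s => G1 s - G1 0 * 1 - m / 2 * (2 * s))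
    (fun s hs => by
      have e := (((h1 s hs).sub ((hasDerivAt_id s).const_mul (G1 0)))).sub
        ((hasDerivAt_pow 2 s).const_mul (m / 2))
      exact e.congr_deriv (by simp)) (fun s hs => by
        have := k1 s hs; linarith) 1 (by simp)
  simp at this
  linarith

/-- The local push-up property of the quadratic disc `l ↦ l v + l² w`. -/
def DiscProp {N : ℕ} (ρ : Cn N → ℝ) (η δ : ℝ) (x v w : Cn N) : Prop :=
  ∀ y, ‖y - x‖ ≤ η → ∃ a : ℂ,
    (∀ l : ℂ, ‖l‖ ≤ 1 → 0 ≤ (l * a).re → ρ y ≤ ρ (y + (l • v + l ^ 2 • w))) ∧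
    (∀ l : ℂ, 1 / 2 ≤ ‖l‖ → ‖l‖ ≤ 1 → ρ y + δ ≤ ρ (y + (l • v + l ^ 2 • w)))

lemma disc_local {N : ℕ} (X : Set (Cn N)) (hX : IsOpen X) (ρ : Cn N → ℝ)
    (hρ : ContDiffOn ℝ (⊤ : ℕ∞) ρ X) (p : Cn N) (hp : p ∈ X) (hL : TwoPosEigen ρ p)
    (R : ℝ) (hR : 0 < R) :
    ∃ v w : Cn N, ‖v‖ + ‖w‖ ≤ R ∧ ∃ η > 0, ∃ δ > 0, DiscProp ρ η δ p v w := by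
  have hcd : ∀ x ∈ X, ContDiffAt ℝ (⊤ : ℕ∞) ρ x := fun x hx => hρ.contDiffAt (hX.mem_nhds hx)
  have hd1 : ∀ x ∈ X, HasFDerivAt ρ (fderiv ℝ ρ x) x := fun x hx =>
    ((hcd x hx).differentiableAt (by simp)).hasFDerivAt
  have hcd1 : ∀ x ∈ X, ContDiffAt ℝ (⊤ : ℕ∞) (fderiv ℝ ρ) x := fun x hx =>
    (hcd x hx).fderiv_right (by simp)
  have hd2 : ∀ x ∈ X, HasFDerivAt (fderiv ℝ ρ) (fderiv ℝ (fderiv ℝ ρ) x) x := fun x hx =>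
    ((hcd1 x hx).differentiableAt (by simp)).hasFDerivAt
  have hcd2 : ∀ x ∈ X, ContDiffAt ℝ (⊤ : ℕ∞) (fderiv ℝ (fderiv ℝ ρ)) x := fun x hx =>
    (hcd1 x hx).fderiv_right (by simp)
  have hsymm : ∀ x y, fderiv ℝ (fderiv ℝ ρ) p x y = fderiv ℝ (fderiv ℝ ρ) p y x := by
    intro x y
    exact (hcd p hp).isSymmSndFDerivAt (by simp; exact WithTop.coe_le_coe.2 (le_top : (2:ℕ∞) ≤ ⊤)) x y
  obtain ⟨W, hW, hpos⟩ := hL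
  obtain ⟨v, w, c, hc, hA0, hH0⟩ := exists_dir (fderiv ℝ (fderiv ℝ ρ) p) hsymm (fderiv ℝ ρ p) W hW (by
    intro v hv hv0
    have := hpos v hv hv0
    unfold LeviForm at this
    rw [iteratedFDeriv_two_apply, iteratedFDeriv_two_apply] at this
    simp at this
    linarith)
  -- uniform positivity near `(p, 0)`
  have hev : ∀ᶠ q : Cn N × ℂ in nhds (p, (0:ℂ)), ∀ e ∈ sphere (0:ℂ) 1,
      c / 2 < fderiv ℝ (fderiv ℝ ρ) q.1 (e • (v + q.2 • w)) (e • (v + q.2 • w))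
        + fderiv ℝ ρ q.1 ((2 * e ^ 2) • w) := by
    apply (isCompact_sphere (0:ℂ) 1).eventually_forall_of_forall_eventually
    intro e he
    have hcont : ContinuousAt (fun q : (Cn N × ℂ) × ℂ =>
        fderiv ℝ (fderiv ℝ ρ) q.1.1 (q.2 • (v + q.1.2 • w)) (q.2 • (v + q.1.2 • w))
        + fderiv ℝ ρ q.1.1 ((2 * q.2 ^ 2) • w)) ((p, 0), e) := by
      have c2 : ContinuousAt (fun q : (Cn N × ℂ) × ℂ => fderiv ℝ (fderiv ℝ ρ) q.1.1) ((p, 0), e) :=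
        ContinuousAt.comp (g := fderiv ℝ (fderiv ℝ ρ)) (hcd2 p hp).continuousAt (by fun_prop)
      have c1 : ContinuousAt (fun q : (Cn N × ℂ) × ℂ => fderiv ℝ ρ q.1.1) ((p, 0), e) :=
        ContinuousAt.comp (g := fderiv ℝ ρ) (hcd1 p hp).continuousAt (by fun_prop)
      have c3 : ContinuousAt (fun q : (Cn N × ℂ) × ℂ => q.2 • (v + q.1.2 • w)) ((p, 0), e) := by
        fun_prop
      have c4 : ContinuousAt (fun q : (Cn N × ℂ) × ℂ => (2 * q.2 ^ 2) • w) ((p, 0), e) := by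
        fun_prop
      exact ((c2.clm_apply c3).clm_apply c3).add (c1.clm_apply c4)
    have hval := hH0 e
    have he1 : ‖e‖ = 1 := by simpa using he
    rw [he1] at hval
    refine hcont.eventually (lt_mem_nhds ?_)
    simp only [zero_smul, add_zero]
    linarith
  obtain ⟨r, hr, hball⟩ := Metric.eventually_nhds_iff.1 (hev.and
    ((continuous_fst.continuousAt (x := (p, (0:ℂ)))).eventually (hX.mem_nhds hp)))
  have hr1 : ∀ (x : Cn N) (μ : ℂ), ‖x - p‖ < r → ‖μ‖ < r → x ∈ X ∧ ∀ e ∈ sphere (0:ℂ) 1,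
      c / 2 < fderiv ℝ (fderiv ℝ ρ) x (e • (v + μ • w)) (e • (v + μ • w))
        + fderiv ℝ ρ x ((2 * e ^ 2) • w) := by
    intro x μ hx hμ
    have := @hball (x, μ) (by
      rw [Prod.dist_eq, dist_eq_norm, dist_eq_norm]
      simpa using ⟨hx, hμ⟩)
    exact ⟨this.2, this.1⟩
  set S := ‖v‖ + ‖w‖ + 1 with hS
  have hS1 : 1 ≤ S := by have := norm_nonneg v; have := norm_nonneg w; linarith
  obtain ⟨t, ht, ht1, htr, htR⟩ : ∃ t > 0, t ≤ 1 / 2 ∧ t * S < r / 2 ∧ t * S ≤ R := by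
    refine ⟨min (1 / 2) (min (r / (4 * S)) (R / S)), by positivity, min_le_left _ _, ?_, ?_⟩
    · have : min (1 / 2) (min (r / (4 * S)) (R / S)) ≤ r / (4 * S) :=
        (min_le_right _ _).trans (min_le_left _ _)
      calc _ ≤ r / (4 * S) * S := by gcongr
        _ = r / 4 := by field_simp
        _ < r / 2 := by linarith
    · have : min (1 / 2) (min (r / (4 * S)) (R / S)) ≤ R / S :=
        (min_le_right _ _).trans (min_le_right _ _)
      calc _ ≤ R / S * S := by gcongr
        _ = R := by field_simp
  have htr2 : t < r / 2 := by nlinarith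
  -- key inequality
  have key : ∀ y, ‖y - p‖ ≤ r / 2 → ∀ l : ℂ, ‖l‖ ≤ t →
      ρ y + fderiv ℝ ρ y (l • v) + c / 4 * ‖l‖ ^ 2 ≤ ρ (y + (l • v + l ^ 2 • w)) := by
    intro y hy l hl
    by_cases hl0 : l = 0
    · simp [hl0]
    have hln : 0 < ‖l‖ := norm_pos_iff.2 hl0
    let γ : ℝ → Cn N := fun s => y + (s • (l • v) + s ^ 2 • (l ^ 2 • w))
    let γ' : ℝ → Cn N := fun s => l • v + (2 * s) • (l ^ 2 • w)
    have hγ : ∀ s, HasDerivAt γ (γ' s) s := by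
      intro s
      have e1 := ((hasDerivAt_id s).smul_const (l • v)).add
        ((hasDerivAt_pow 2 s).smul_const (l ^ 2 • w))
      have e2 := e1.const_add y
      exact e2.congr_deriv (by simp [γ'])
    have hγ' : ∀ s, HasDerivAt γ' ((2:ℝ) • (l ^ 2 • w)) s := by
      intro s
      have e1 := (((hasDerivAt_id s).const_mul 2).smul_const (l ^ 2 • w)).const_add (l • v)
      exact e1.congr_deriv (by simp)
    have hγp : ∀ s ∈ Icc (0:ℝ) 1, ‖γ s - p‖ < r := by
      intro s hs
      have h1 : ‖γ s - p‖ ≤ ‖y - p‖ + (‖s • (l • v)‖ + ‖s ^ 2 • (l ^ 2 • w)‖) := by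
        have : γ s - p = (y - p) + (s • (l • v) + s ^ 2 • (l ^ 2 • w)) := by simp only [γ]; abel
        rw [this]
        exact (norm_add_le _ _).trans (by gcongr; exact norm_add_le _ _)
      have h2 : ‖s • (l • v)‖ ≤ t * ‖v‖ := by
        rw [norm_smul, norm_smul, Real.norm_of_nonneg hs.1]
        calc s * (‖l‖ * ‖v‖) ≤ 1 * (t * ‖v‖) := by gcongr; exact hs.2
          _ = _ := by ring
      have h3 : ‖s ^ 2 • (l ^ 2 • w)‖ ≤ t * ‖w‖ := by
        rw [norm_smul, norm_smul, norm_pow, norm_pow, Real.norm_of_nonneg hs.1]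
        have : s ^ 2 ≤ 1 := by nlinarith [hs.1, hs.2]
        have h4 : ‖l‖ ^ 2 ≤ t := by nlinarith
        calc s ^ 2 * (‖l‖ ^ 2 * ‖w‖) ≤ 1 * (t * ‖w‖) := by gcongr
          _ = _ := by ring
      have : t * (‖v‖ + ‖w‖) ≤ t * S := by gcongr; linarith
      nlinarith
    have hγX : ∀ s ∈ Icc (0:ℝ) 1, γ s ∈ X := fun s hs =>
      (hr1 (γ s) 0 (hγp s hs) (by simpa using hr)).1
    have T := taylor2 (fun s => ρ (γ s)) (fun s => fderiv ℝ ρ (γ s) (γ' s))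
      (fun s => fderiv ℝ (fderiv ℝ ρ) (γ s) (γ' s) (γ' s) + fderiv ℝ ρ (γ s) ((2:ℝ) • (l ^ 2 • w)))
      (c / 2 * ‖l‖ ^ 2) (fun s hs => (hd1 _ (hγX s hs)).comp_hasDerivAt s (hγ s))
      (fun s hs => ((hd2 _ (hγX s hs)).comp_hasDerivAt s (hγ s)).clm_apply (hγ' s)) (by
        intro s hs
        set e : ℂ := l / ‖l‖ with he
        have he1 : ‖e‖ = 1 := by simp [he, hln.ne']
        have hle : l = (‖l‖ : ℝ) • e := by
          rw [he, Complex.real_smul, mul_div_cancel₀]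
          exact_mod_cast hln.ne'
        have h := (hr1 (γ s) (2 * s * l) (hγp s hs) (by
          simp only [norm_mul, Complex.norm_real, Real.norm_of_nonneg hs.1]
          simp
          nlinarith [hs.1, hs.2])).2 e (by simpa using he1)
        have E1 : γ' s = (‖l‖ : ℝ) • (e • (v + (2 * s * l : ℂ) • w)) := by
          rw [← smul_assoc, ← hle, smul_add, smul_smul]
          simp only [γ']
          congr 1
          ext i
          simp only [PiLp.smul_apply, Complex.real_smul, smul_eq_mul]
          push_cast
          ring
        have E2 : (2:ℝ) • (l ^ 2 • w) = (‖l‖ ^ 2 : ℝ) • ((2 * e ^ 2) • w) := by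
          ext i
          simp only [PiLp.smul_apply, Complex.real_smul, smul_eq_mul]
          have : l ^ 2 = (‖l‖ : ℂ) ^ 2 * e ^ 2 := by
            conv_lhs => rw [hle]
            rw [Complex.real_smul]; ring
          rw [this]
          push_cast
          ring
        rw [E1, E2]
        simp only [map_smul, _root_.smul_apply, smul_eq_mul]
        nlinarith [sq_pos_of_pos hln])
    have g1 : γ 1 = y + (l • v + l ^ 2 • w) := by simp [γ]
    have g0 : γ 0 = y := by simp [γ]
    have g0' : γ' 0 = l • v := by simp [γ']
    simp only [g1, g0, g0'] at T
    linarith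
  -- choice of η
  obtain ⟨η0, hη0, hη0'⟩ := Metric.continuousAt_iff.1 (hcd1 p hp).continuousAt
    (c * t / (32 * S)) (by positivity)
  refine ⟨t • v, t ^ 2 • w, ?_, min (r / 2) (η0 / 2), by positivity, c * t ^ 2 / 32, by positivity, ?_⟩
  · rw [norm_smul, norm_smul, norm_pow, Real.norm_of_nonneg ht.le]
    have : t ^ 2 ≤ t := by nlinarith
    have h2 : t ^ 2 * ‖w‖ ≤ t * ‖w‖ := by gcongr
    nlinarith
  intro y hy
  have hy1 := hy.trans (min_le_left _ _)
  have hy2 := hy.trans (min_le_right _ _)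
  have hAy : ‖fderiv ℝ ρ y - fderiv ℝ ρ p‖ < c * t / (32 * S) := by
    rw [← dist_eq_norm]
    exact hη0' (by rw [dist_eq_norm]; linarith)
  have hAyl : ∀ l : ℂ, ‖l‖ ≤ 1 → |fderiv ℝ ρ y (l • (t • v))| ≤ c * t ^ 2 / 32 := by
    intro l hl
    have e0 : fderiv ℝ ρ y (l • (t • v)) = t * ((fderiv ℝ ρ y - fderiv ℝ ρ p) (l • v)) := by
      rw [smul_comm, map_smul, _root_.sub_apply, hA0]
      simp
    rw [e0, abs_mul, abs_of_pos ht]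
    have e1 : |(fderiv ℝ ρ y - fderiv ℝ ρ p) (l • v)| ≤ c * t / (32 * S) * S := by
      calc _ ≤ ‖fderiv ℝ ρ y - fderiv ℝ ρ p‖ * ‖l • v‖ := ContinuousLinearMap.le_opNorm _ _
        _ ≤ c * t / (32 * S) * S := by
          gcongr
          rw [norm_smul]
          have : ‖l‖ * ‖v‖ ≤ 1 * ‖v‖ := by gcongr
          have := norm_nonneg w
          linarith
    have e2 : c * t / (32 * S) * S = c * t / 32 := by field_simp
    rw [e2] at e1
    calc _ ≤ t * (c * t / 32) := by gcongr
      _ = _ := by ring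
  have hkey : ∀ l : ℂ, ‖l‖ ≤ 1 → ρ y + fderiv ℝ ρ y (l • (t • v)) + c / 4 * (t * ‖l‖) ^ 2
      ≤ ρ (y + (l • t • v + l ^ 2 • t ^ 2 • w)) := by
    intro l hl
    have := key y hy1 (t • l) (by
      rw [norm_smul, Real.norm_of_nonneg ht.le]; nlinarith)
    rw [norm_smul, Real.norm_of_nonneg ht.le] at this
    have a1 : (t • l) • v = l • t • v := by rw [smul_assoc, smul_comm]
    have a2 : (t • l) ^ 2 • w = l ^ 2 • t ^ 2 • w := by
      rw [smul_pow, smul_assoc, smul_comm]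
    rw [a1, a2] at this
    exact this
  refine ⟨⟨fderiv ℝ ρ y (t • v), -fderiv ℝ ρ y (Complex.I • (t • v))⟩, fun l hl hre => ?_,
    fun l hl1 hl => ?_⟩
  · rw [← A_expand] at hre
    have := hkey l hl
    have : 0 ≤ c / 4 * (t * ‖l‖) ^ 2 := by positivity
    linarith
  · have h1 := hkey l hl
    have h2 := (abs_le.1 (hAyl l hl)).1
    have h3 : c / 4 * (t * (1/2)) ^ 2 ≤ c / 4 * (t * ‖l‖) ^ 2 := by gcongr
    have h4 : c / 4 * (t * (1/2)) ^ 2 = c * t ^ 2 / 16 := by ring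
    linarith

lemma disc_compact {N : ℕ} (X : Set (Cn N)) (hX : IsOpen X) (ρ : Cn N → ℝ)
    (hρ : ContDiffOn ℝ (⊤ : ℕ∞) ρ X) (K : Set (Cn N)) (hK : IsCompact K) (hKX : K ⊆ X)
    (hL : ∀ p ∈ K, TwoPosEigen ρ p) (R : ℝ) (hR : 0 < R) :
    ∃ η > 0, ∃ δ > 0, ∀ x ∈ K, ∃ v w : Cn N, ‖v‖ + ‖w‖ ≤ R ∧ DiscProp ρ η δ x v w := by
  refine hK.induction_on (p := fun s => ∃ η > 0, ∃ δ > 0, ∀ x ∈ s, ∃ v w : Cn N, ‖v‖ + ‖w‖ ≤ R ∧ DiscProp ρ η δ x v w) ?_ ?_ ?_ ?_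
  · exact ⟨1, one_pos, 1, one_pos, by simp⟩
  · rintro s t hst ⟨η, hη, δ, hδ, h⟩
    exact ⟨η, hη, δ, hδ, fun x hx => h x (hst hx)⟩
  · rintro s t ⟨η, hη, δ, hδ, h⟩ ⟨η', hη', δ', hδ', h'⟩
    have mono : ∀ (η1 δ1 η2 δ2 : ℝ) (x v w : Cn N), η2 ≤ η1 → δ2 ≤ δ1 →
        DiscProp ρ η1 δ1 x v w → DiscProp ρ η2 δ2 x v w := by
      intro η1 δ1 η2 δ2 x v w h1 h2 h y hy
      obtain ⟨a, ha, hb⟩ := h y (hy.trans h1)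
      exact ⟨a, ha, fun l hl hl' => by have := hb l hl hl'; linarith⟩
    refine ⟨min η η', lt_min hη hη', min δ δ', lt_min hδ hδ', ?_⟩
    rintro x (hx | hx)
    · obtain ⟨v, w, hvw, hd⟩ := h x hx
      exact ⟨v, w, hvw, mono _ _ _ _ _ _ _ (min_le_left _ _) (min_le_left _ _) hd⟩
    · obtain ⟨v, w, hvw, hd⟩ := h' x hx
      exact ⟨v, w, hvw, mono _ _ _ _ _ _ _ (min_le_right _ _) (min_le_right _ _) hd⟩
  · intro p hp
    obtain ⟨v, w, hvw, η, hη, δ, hδ, h⟩ := disc_local X hX ρ hρ p (hKX hp) (hL p hp) R hR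
    refine ⟨ball p (η / 2) , mem_nhdsWithin_of_mem_nhds (ball_mem_nhds _ (by positivity)), η / 2,
      by positivity, δ, hδ, ?_⟩
    intro x hx
    refine ⟨v, w, hvw, fun y hy => h y ?_⟩
    rw [mem_ball, dist_eq_norm] at hx
    calc ‖y - p‖ = ‖(y - x) + (x - p)‖ := by congr 1; abel
      _ ≤ _ := norm_add_le _ _
      _ ≤ η := by linarith

lemma clm_re (A : ℂ →L[ℝ] ℝ) (z : ℂ) : A z = (z * (starRingEnd ℂ) ⟨A 1, A I⟩).re := by
  have : A z = A (z.re • (1:ℂ) + z.im • I) := by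
    congr 1
    apply Complex.ext <;> simp
  rw [this, map_add, map_smul, map_smul]
  simp

lemma frontier_compact {D : Set ℂ} (hD : Bornology.IsBounded D) : IsCompact (frontier D) :=
  Metric.isCompact_of_isClosed_isBounded isClosed_frontier
    (hD.closure.subset frontier_subset_closure)

lemma boundary_geom (D : Set ℂ) (hDopen : IsOpen D) (hD : Bornology.IsBounded D)
    (hsb : SmoothlyBounded D) (ε : ℝ) (hε : 0 < ε) :
    ∃ t0 > 0, ∀ p ∈ frontier D, ∃ ν : ℂ, ‖ν‖ = 1 ∧ ∀ z, ‖z - p‖ ≤ t0 →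
      (z ∈ closure D → ((z - p) * (starRingEnd ℂ) ν).re ≤ ε * ‖z - p‖) ∧
      (z ∈ frontier D → |((z - p) * (starRingEnd ℂ) ν).re| ≤ ε * ‖z - p‖) := by
  obtain ⟨V, hV, hfV, v, hv, hDV, hfr, hdv⟩ := hsb
  have main : ∃ t0 > 0, ∀ p ∈ frontier D ∩ frontier D, ∃ ν : ℂ, ‖ν‖ = 1 ∧ ∀ z, ‖z - p‖ ≤ t0 →
      (z ∈ closure D → ((z - p) * (starRingEnd ℂ) ν).re ≤ ε * ‖z - p‖) ∧
      (z ∈ frontier D → |((z - p) * (starRingEnd ℂ) ν).re| ≤ ε * ‖z - p‖) := by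
    refine (frontier_compact hD).induction_on (p := fun s => ∃ t0 > 0, ∀ p ∈ s ∩ frontier D, ∃ ν : ℂ, ‖ν‖ = 1 ∧ ∀ z, ‖z - p‖ ≤ t0 →
      (z ∈ closure D → ((z - p) * (starRingEnd ℂ) ν).re ≤ ε * ‖z - p‖) ∧
      (z ∈ frontier D → |((z - p) * (starRingEnd ℂ) ν).re| ≤ ε * ‖z - p‖)) ?_ ?_ ?_ ?_
    · exact ⟨1, one_pos, by simp⟩
    · rintro s t hst ⟨t0, ht0, h⟩
      exact ⟨t0, ht0, fun p hp => h p ⟨hst hp.1, hp.2⟩⟩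
    · rintro s t ⟨t0, ht0, h⟩ ⟨t1, ht1, h'⟩
      refine ⟨min t0 t1, lt_min ht0 ht1, ?_⟩
      rintro p ⟨hp | hp, hpf⟩
      · obtain ⟨ν, h1, h2⟩ := h p ⟨hp, hpf⟩
        exact ⟨ν, h1, fun z hz => h2 z (hz.trans (min_le_left _ _))⟩
      · obtain ⟨ν, h1, h2⟩ := h' p ⟨hp, hpf⟩
        exact ⟨ν, h1, fun z hz => h2 z (hz.trans (min_le_right _ _))⟩
    · intro p0 hp0
      have hst : HasStrictFDerivAt v (fderiv ℝ v p0) p0 :=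
        (hv.contDiffAt (hV.mem_nhds (hfV hp0))).hasStrictFDerivAt (by simp)
      set A := fderiv ℝ v p0 with hA
      have hA0 := hdv p0 hp0
      set g : ℂ := ⟨A 1, A I⟩ with hg
      have hg0 : g ≠ 0 := by
        intro h0
        apply hA0
        ext
        all_goals
          rw [← hA, clm_re A, ← hg, h0]
          simp
      have hgn : 0 < ‖g‖ := norm_pos_iff.2 hg0
      have hev := hst.isLittleO.def (c := ε * ‖g‖) (by positivity)
      obtain ⟨r, hr, hball⟩ := Metric.eventually_nhds_iff.1 (hev.and
        ((continuous_fst.continuousAt (x := (p0, p0))).eventually (hV.mem_nhds (hfV hp0))))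
      refine ⟨ball p0 (r / 2), mem_nhdsWithin_of_mem_nhds (ball_mem_nhds _ (by positivity)), r / 3,
        by positivity, ?_⟩
      rintro p ⟨hp, hpf⟩
      refine ⟨g / ‖g‖, by simp [hgn.ne'], ?_⟩
      intro z hz
      rw [mem_ball] at hp
      have hz' : dist z p0 < r := by
        have := dist_triangle z p p0
        rw [dist_eq_norm z p] at this
        linarith
      have h := @hball (z, p) (by
        rw [Prod.dist_eq]
        exact max_lt hz' (by linarith))
      have hzV : z ∈ V := h.2
      have hvp : v p = 0 := by rw [hfr] at hpf; exact hpf.2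
      have h1 := h.1
      simp only [Real.norm_eq_abs] at h1
      have hAz : A (z - p) = ‖g‖ * ((z - p) * (starRingEnd ℂ) (g / ‖g‖)).re := by
        rw [clm_re A, ← hg]
        have : (z - p) * (starRingEnd ℂ) g = (‖g‖ : ℝ) * ((z - p) * (starRingEnd ℂ) (g / ‖g‖)) := by
          have h0 : ((‖g‖ : ℝ) : ℂ) ≠ 0 := by exact_mod_cast hgn.ne'
          rw [map_div₀, Complex.conj_ofReal]
          field_simp
        rw [this, Complex.re_ofReal_mul]
      rw [hAz, hvp] at h1
      have h2 := abs_le.1 h1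
      have hfrz : z ∈ frontier D → v z = 0 := by
        intro hz; rw [hfr] at hz; exact hz.2
      constructor
      · intro hzD
        have hvz : v z ≤ 0 := by
          by_cases hzD' : z ∈ D
          · have : z ∈ D ∩ V := ⟨hzD', hzV⟩
            rw [hDV] at this
            exact this.2.le
          · exact (hfrz (by rw [hDopen.frontier_eq]; exact ⟨hzD, hzD'⟩)).le
        have : ‖g‖ * ((z - p) * (starRingEnd ℂ) (g / ‖g‖)).re ≤ ‖g‖ * (ε * ‖z - p‖) := by
          nlinarith [h2.1]
        exact le_of_mul_le_mul_left this hgn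
      · intro hzD
        rw [hfrz hzD] at h1
        have : ‖g‖ * |((z - p) * (starRingEnd ℂ) (g / ‖g‖)).re| ≤ ‖g‖ * (ε * ‖z - p‖) := by
          have h3 : |0 - 0 - ‖g‖ * ((z - p) * (starRingEnd ℂ) (g / ‖g‖)).re| = 
              ‖g‖ * |((z - p) * (starRingEnd ℂ) (g / ‖g‖)).re| := by
            rw [sub_self, zero_sub, abs_neg, abs_mul, abs_of_pos hgn]
          rw [h3] at h1
          linarith
        exact le_of_mul_le_mul_left this hgn
  obtain ⟨t0, ht0, h⟩ := main
  exact ⟨t0, ht0, fun p hp => h p ⟨hp, hp⟩⟩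

/-- inverse Joukowski map -/
def jq (z : ℂ) : ℂ := (1 - (z⁻¹) ^ 2) ^ (1 / 2 : ℂ)
def js (z : ℂ) : ℂ := (z * (1 + jq z))⁻¹

lemma j_slit {z : ℂ} (h : z.im ≠ 0 ∨ 1 < ‖z‖) : 1 - (z⁻¹) ^ 2 ∈ Complex.slitPlane := by
  rw [Complex.mem_slitPlane_iff]
  by_contra hc
  push Not at hc
  obtain ⟨h1, h2⟩ := hc
  -- z⁻¹ ^ 2 is real and ≥ 1
  set w := z⁻¹ with hw
  have hz : z = w⁻¹ := by simp [hw]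
  have e1 : (w ^ 2).re = w.re ^ 2 - w.im ^ 2 := by rw [pow_two, mul_re]; ring
  have e2 : (w ^ 2).im = 2 * w.re * w.im := by rw [pow_two, mul_im]; ring
  rw [sub_re, one_re, e1] at h1
  rw [sub_im, one_im, e2] at h2
  have hre : w.re ≠ 0 := by
    intro h0; rw [h0] at h1; nlinarith [sq_nonneg w.im]
  have him : w.im = 0 := by
    have : w.re * w.im = 0 := by linarith
    exact (mul_eq_zero.1 this).resolve_left hre
  have hn : 1 ≤ ‖w‖ := by
    have : ‖w‖ ^ 2 = w.re ^ 2 + w.im ^ 2 := by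
      rw [← Complex.normSq_eq_norm_sq, Complex.normSq_apply]; ring
    nlinarith [norm_nonneg w]
  rcases h with h | h
  · apply h
    rw [hz, inv_im, him]; simp
  · rw [hz, norm_inv] at h
    have := inv_le_one_of_one_le₀ hn
    linarith

lemma jq_re {z : ℂ} (h : z.im ≠ 0 ∨ 1 < ‖z‖) : 0 < (jq z).re := by
  have hs := j_slit h
  have h0 := Complex.slitPlane_ne_zero hs
  rw [jq, Complex.cpow_def_of_ne_zero h0, Complex.exp_re]
  apply mul_pos (Real.exp_pos _)
  apply Real.cos_pos_of_mem_Ioo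
  have e : (log (1 - (z⁻¹) ^ 2) * (1 / 2 : ℂ)).im = (arg (1 - (z⁻¹) ^ 2)) / 2 := by
    rw [mul_im, log_im]
    norm_num
    ring
  rw [e]
  have h1 := Complex.neg_pi_lt_arg (1 - (z⁻¹) ^ 2)
  have h2 := Complex.arg_le_pi (1 - (z⁻¹) ^ 2)
  have h3 := (Complex.mem_slitPlane_iff_arg.1 hs).1
  have h4 := lt_of_le_of_ne h2 h3
  constructor <;> linarith

lemma jq_sq (z : ℂ) : (jq z) ^ 2 = 1 - (z⁻¹) ^ 2 := by
  rw [jq, ← Complex.cpow_nat_mul]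
  norm_num

lemma jdom_ne {z : ℂ} (h : z.im ≠ 0 ∨ 1 < ‖z‖) : z ≠ 0 := by
  rintro rfl
  rcases h with h | h
  · simp at h
  · simp at h; linarith

lemma one_add_norm {q : ℂ} (h : 0 < q.re) : 1 ≤ ‖1 + q‖ := by
  have := Complex.re_le_norm (1 + q)
  simp at this
  linarith

lemma js_ne {z : ℂ} (h : z.im ≠ 0 ∨ 1 < ‖z‖) : js z ≠ 0 := by
  rw [js]
  have h1 := one_add_norm (jq_re h)
  have : 1 + jq z ≠ 0 := by
    intro h0; rw [h0] at h1; simp at h1; linarith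
  exact inv_ne_zero (mul_ne_zero (jdom_ne h) this)

lemma js_eq {z : ℂ} (h : z.im ≠ 0 ∨ 1 < ‖z‖) : js z = z * (1 - jq z) := by
  have h1 := one_add_norm (jq_re h)
  have h2 : 1 + jq z ≠ 0 := by
    intro h0; rw [h0] at h1; simp at h1; linarith
  have h3 := jdom_ne h
  rw [js]
  refine (eq_inv_of_mul_eq_one_left ?_).symm
  have : z * (1 - jq z) * (z * (1 + jq z)) = z ^ 2 * (1 - jq z ^ 2) := by ring
  rw [this, jq_sq]
  field_simp
  ring

lemma js_add {z : ℂ} (h : z.im ≠ 0 ∨ 1 < ‖z‖) : js z + (js z)⁻¹ = 2 * z := by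
  conv_lhs => rw [js_eq h]
  rw [← js_eq h, js, inv_inv]
  rw [← js, js_eq h]
  ring

lemma js_le {z : ℂ} (h : z.im ≠ 0 ∨ 1 < ‖z‖) : ‖js z‖ ≤ ‖z‖⁻¹ := by
  rw [js, norm_inv, norm_mul]
  have h1 := one_add_norm (jq_re h)
  have : 0 < ‖z‖ := norm_pos_iff.2 (jdom_ne h)
  gcongr
  nlinarith

lemma js_lt {z : ℂ} (h : z.im ≠ 0 ∨ 1 < ‖z‖) : ‖js z‖ < 1 := by
  have h1 := one_add_norm (jq_re h)
  have hz : 0 < ‖z‖ := norm_pos_iff.2 (jdom_ne h)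
  have h2 : ‖1 - jq z‖ < ‖1 + jq z‖ := by
    apply lt_of_pow_lt_pow_left₀ 2 (norm_nonneg _)
    rw [← Complex.normSq_eq_norm_sq, ← Complex.normSq_eq_norm_sq, Complex.normSq_apply,
      Complex.normSq_apply]
    have := jq_re h
    simp
    nlinarith
  have h3 : ‖js z‖ * ‖js z‖ = ‖1 - jq z‖ / ‖1 + jq z‖ := by
    conv_lhs => 
      congr
      · rw [js_eq h]
      · rw [js]
    rw [norm_mul, norm_inv, norm_mul]
    field_simp
  have h4 : ‖js z‖ * ‖js z‖ < 1 := by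
    rw [h3, div_lt_one (by linarith)]; exact h2
  nlinarith [norm_nonneg (js z)]

lemma js_diff {z : ℂ} (h : z.im ≠ 0 ∨ 1 < ‖z‖) : DifferentiableAt ℂ js z := by
  have h0 := jdom_ne h
  have hs := j_slit h
  have hn := js_ne h
  unfold js jq
  apply DifferentiableAt.inv
  · apply DifferentiableAt.mul differentiableAt_id
    apply DifferentiableAt.const_add
    exact DifferentiableAt.cpow_const (f := fun y : ℂ => 1 - (y⁻¹) ^ 2)
      (((differentiableAt_inv h0).pow 2).const_sub 1) hs
  · rw [js, jq] at hn
    exact fun h => hn (by rw [h, inv_zero])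

lemma norm_pow_sub_le (a b : ℂ) (ha : ‖a‖ ≤ 1) (hb : ‖b‖ ≤ 1) (n : ℕ) :
    ‖a ^ n - b ^ n‖ ≤ n * ‖a - b‖ := by
  induction n with
  | zero => simp
  | succ m ih =>
    have : a ^ (m + 1) - b ^ (m + 1) = a ^ m * (a - b) + (a ^ m - b ^ m) * b := by ring
    rw [this]
    have h1 : ‖a ^ m‖ ≤ 1 := by rw [norm_pow]; exact pow_le_one₀ (norm_nonneg _) ha
    calc _ ≤ ‖a ^ m * (a - b)‖ + ‖(a ^ m - b ^ m) * b‖ := norm_add_le _ _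
      _ ≤ 1 * ‖a - b‖ + (m * ‖a - b‖) * 1 := by
        rw [norm_mul, norm_mul]
        gcongr
      _ = _ := by push_cast; ring

/-- real bounds for the inverse Joukowski map -/
lemma js_coords {z : ℂ} (h : z.im ≠ 0 ∨ 1 < ‖z‖) :
    (js z).im * (‖js z‖ ^ 2 - 1) = 2 * z.im * ‖js z‖ ^ 2 ∧
    (js z).re * (‖js z‖ ^ 2 + 1) = 2 * z.re * ‖js z‖ ^ 2 := by
  have h1 := js_add h
  have h2 := js_ne h
  set s := js z
  have h3 : s * (‖s‖ ^ 2 : ℝ) + (starRingEnd ℂ) s = 2 * z * (‖s‖ ^ 2 : ℝ) := by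
    rw [← h1, add_mul, ← Complex.normSq_eq_norm_sq, ← Complex.mul_conj]
    field_simp
  have e1 := congrArg Complex.re h3
  have e2 := congrArg Complex.im h3
  simp only [add_re, mul_re, ofReal_re, ofReal_im, conj_re, re_ofNat, im_ofNat, add_im, mul_im, conj_im] at e1 e2
  constructor <;> linarith

set_option maxHeartbeats 1600000 in
lemma scalar_fn (e κ : ℝ) (he : 0 < e) (hκ : 0 < κ) :
    ∃ θ > 0, θ ≤ κ ∧ ∃ Ω : ℂ → ℂ,
      DifferentiableOn ℂ Ω {ζ | -(2 * θ) < ζ.im ∨ 3 / 2 < ‖ζ‖} ∧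
      (∀ ζ : ℂ, (-(2 * θ) < ζ.im ∨ 3 / 2 < ‖ζ‖) → ‖Ω ζ‖ ≤ 1) ∧
      (∀ ζ : ℂ, 2 ≤ ‖ζ‖ → ‖Ω ζ‖ ≤ e / ‖ζ‖ ^ 3) ∧
      (∀ ζ : ℂ, |ζ.im| ≤ θ → |ζ.re| ≤ 1 → 1 / 2 ≤ ‖Ω ζ‖) ∧
      (∀ ζ : ℂ, |ζ.im| ≤ θ → ‖Ω ζ‖ < 1 / 2 → ‖Ω ζ - (‖Ω ζ‖ : ℂ)‖ ≤ e) ∧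
      (∀ ζ : ℂ, |ζ.im| ≤ θ → 1 + κ ≤ |ζ.re| → ‖Ω ζ‖ ≤ e) := by
  set κ' := min κ (1 / 4) with hκ'
  have hκ'0 : 0 < κ' := by positivity
  have hκ'1 : κ' ≤ 1 / 4 := min_le_right _ _
  have hκ'2 : κ' ≤ κ := min_le_left _ _
  obtain ⟨m, hm1, hm2⟩ : ∃ m : ℕ, (2 / 3 : ℝ) ^ m ≤ e / 4 ∧ (1 - κ') ^ m ≤ e / 4 := by
    obtain ⟨m1, h1⟩ := exists_pow_lt_of_lt_one (show 0 < e / 4 by positivity) (show (2 / 3 : ℝ) < 1 by norm_num)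
    obtain ⟨m2, h2⟩ := exists_pow_lt_of_lt_one (show 0 < e / 4 by positivity) (show 1 - κ' < 1 by linarith)
    refine ⟨max m1 m2, ?_, ?_⟩
    · exact (pow_le_pow_of_le_one (by norm_num) (by norm_num) (le_max_left _ _)).trans h1.le
    · exact (pow_le_pow_of_le_one (by linarith) (by linarith) (le_max_right _ _)).trans h2.le
  set J : ℕ := m + 2 with hJ
  have hJ1 : (1 : ℝ) ≤ J := by rw [hJ]; push_cast; linarith [(Nat.cast_nonneg m : (0:ℝ) ≤ m)]
  obtain ⟨η, hη, hη1, hη2, hη3, hη4⟩ : ∃ η > 0, η ≤ 2 * κ ∧ η ≤ 1 / 4 ∧ 6 * η < 1 / (4 * J ^ 2) ∧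
      12 * J ^ 2 * η ≤ e := by
    refine ⟨min (min (2 * κ) (1 / 4)) (min (1 / (32 * J ^ 2)) (e / (12 * J ^ 2))), by positivity,
      (min_le_left _ _).trans (min_le_left _ _), (min_le_left _ _).trans (min_le_right _ _), ?_, ?_⟩
    · have : min (min (2 * κ) (1 / 4)) (min (1 / (32 * (J:ℝ) ^ 2)) (e / (12 * J ^ 2))) ≤ 1 / (32 * J ^ 2) :=
        (min_le_right _ _).trans (min_le_left _ _)
      calc _ ≤ 6 * (1 / (32 * (J:ℝ) ^ 2)) := by gcongr
        _ < 1 / (4 * J ^ 2) := by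
          rw [mul_one_div, div_lt_div_iff₀ (by positivity) (by positivity)]
          have : (0:ℝ) < J ^ 2 := by positivity
          nlinarith
    · have : min (min (2 * κ) (1 / 4)) (min (1 / (32 * (J:ℝ) ^ 2)) (e / (12 * J ^ 2))) ≤ e / (12 * J ^ 2) :=
        (min_le_right _ _).trans (min_le_right _ _)
      calc _ ≤ 12 * J ^ 2 * (e / (12 * (J:ℝ) ^ 2)) := by gcongr
        _ = e := by field_simp
  have him : ∀ ζ : ℂ, (ζ + η * I).im = ζ.im + η := by intro ζ; simp
  have hre : ∀ ζ : ℂ, (ζ + η * I).re = ζ.re := by intro ζ; simp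
  have hnrm : ∀ ζ : ℂ, ‖ζ‖ - η ≤ ‖ζ + η * I‖ := by
    intro ζ
    have := norm_sub_le (ζ + η * I) (η * I)
    simp [abs_of_pos hη] at this
    linarith
  have hdom : ∀ ζ : ℂ, (-(2 * (η / 2)) < ζ.im ∨ 3 / 2 < ‖ζ‖) → 
      ((ζ + η * I).im ≠ 0 ∨ 1 < ‖ζ + η * I‖) := by
    rintro ζ (h | h)
    · left; rw [him]; linarith
    · right; have := hnrm ζ; linarith
  have hdom1 : ∀ ζ : ℂ, |ζ.im| ≤ η / 2 → ((ζ + η * I).im ≠ 0 ∨ 1 < ‖ζ + η * I‖) := by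
    intro ζ h
    exact hdom ζ (Or.inl (by have := (abs_le.1 h).1; linarith))
  have hΩn : ∀ ζ : ℂ, ‖js (ζ + η * I) ^ (2 * J)‖ = (‖js (ζ + η * I)‖ ^ 2) ^ J := by
    intro ζ; rw [norm_pow, pow_mul]
  have hbern : ∀ u : ℝ, 0 ≤ u → u ^ J < 1 / 2 → 1 / (2 * J) ≤ 1 - u := by
    intro u hu h
    have := one_add_mul_le_pow (a := u - 1) (by linarith) J
    have e1 : (1 + (u - 1)) ^ J = u ^ J := by congr 1; ring
    rw [e1] at this
    rw [div_le_iff₀ (by positivity)]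
    nlinarith
  have hybound : ∀ ζ : ℂ, |ζ.im| ≤ η / 2 → |(js (ζ + η * I)).im| * (1 - ‖js (ζ + η * I)‖ ^ 2) ≤
      3 * η * ‖js (ζ + η * I)‖ ^ 2 := by
    intro ζ h
    have h1 := (js_coords (hdom1 ζ h)).1
    have h2 := js_lt (hdom1 ζ h)
    have hu : ‖js (ζ + η * I)‖ ^ 2 < 1 := by nlinarith [norm_nonneg (js (ζ + η * I))]
    rw [him] at h1
    have h3 : |(js (ζ + η * I)).im| * (1 - ‖js (ζ + η * I)‖ ^ 2) = |2 * (ζ.im + η) * ‖js (ζ + η * I)‖ ^ 2| := by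
      rw [← h1, abs_mul, abs_sub_comm, abs_of_pos (by linarith : 0 < 1 - ‖js (ζ + η * I)‖ ^ 2)]
    rw [h3, abs_mul, abs_of_nonneg (sq_nonneg ‖js (ζ + η * I)‖)]
    gcongr
    have := abs_le.1 h
    rw [abs_of_pos (by linarith)]
    linarith
  refine ⟨η / 2, by positivity, by linarith, fun ζ => js (ζ + η * I) ^ (2 * J), ?_, ?_, ?_, ?_, ?_, ?_⟩
  · intro ζ hζ
    apply DifferentiableAt.differentiableWithinAt
    apply DifferentiableAt.fun_pow
    exact DifferentiableAt.comp (g := js) ζ (js_diff (hdom ζ hζ)) (by fun_prop)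
  · intro ζ hζ
    rw [norm_pow]
    exact pow_le_one₀ (norm_nonneg _) (js_lt (hdom ζ hζ)).le
  · intro ζ hζ
    have h1 := js_le (hdom ζ (Or.inr (by linarith)))
    have h2 := hnrm ζ
    have h3 : ‖js (ζ + η * I)‖ ≤ 4 / (3 * ‖ζ‖) := by
      refine h1.trans ?_
      rw [inv_le_comm₀ (by linarith) (by positivity), inv_div]
      linarith
    have h4 : 4 / (3 * ‖ζ‖) ≤ 2 / 3 := by
      rw [div_le_div_iff₀ (by positivity) (by norm_num)]; linarith
    simp only [norm_pow]
    have h5 : 2 * J = 3 + (m + (m + 1)) := by omega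
    have h6 : ‖js (ζ + η * I)‖ ^ (m + (m + 1)) ≤ e / 4 := by
      calc _ ≤ (2 / 3 : ℝ) ^ (m + (m + 1)) := by gcongr; exact h3.trans h4
        _ ≤ (2 / 3 : ℝ) ^ m := pow_le_pow_of_le_one (by norm_num) (by norm_num) (by omega)
        _ ≤ _ := hm1
    rw [h5, pow_add]
    calc _ ≤ (4 / (3 * ‖ζ‖)) ^ 3 * (e / 4) := by gcongr
      _ = (64 / 108) * (e / ‖ζ‖ ^ 3) := by field_simp; norm_num
      _ ≤ 1 * (e / ‖ζ‖ ^ 3) := by gcongr; norm_num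
      _ = _ := one_mul _
  · intro ζ h1 h2
    simp only [hΩn]
    by_contra hc
    push Not at hc
    have hb := hbern _ (sq_nonneg _) hc
    have h3 := hybound ζ h1
    have h4 := (js_coords (hdom1 ζ h1)).2
    rw [hre] at h4
    have hr1 := js_lt (hdom1 ζ h1)
    have hr0 : 0 < ‖js (ζ + η * I)‖ := norm_pos_iff.2 (js_ne (hdom1 ζ h1))
    have hn2 : ‖js (ζ + η * I)‖ ^ 2 = (js (ζ + η * I)).re ^ 2 + (js (ζ + η * I)).im ^ 2 := by
      rw [← Complex.normSq_eq_norm_sq, Complex.normSq_apply]; ring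
    set u := ‖js (ζ + η * I)‖ ^ 2 with hu
    set x := (js (ζ + η * I)).re
    set y := (js (ζ + η * I)).im
    have hu0 : 0 < u := by positivity
    have hu1 : u < 1 := by nlinarith
    have hx : x ^ 2 * (1 + u) ^ 2 ≤ 4 * u ^ 2 := by
      have : x ^ 2 * (1 + u) ^ 2 = (2 * ζ.re * u) ^ 2 := by rw [← h4]; ring
      rw [this]
      have : ζ.re ^ 2 ≤ 1 := by rw [← sq_abs]; nlinarith [abs_nonneg ζ.re]
      nlinarith [sq_nonneg u]
    have hy : y ^ 2 * (1 - u) ^ 2 ≤ 9 * η ^ 2 * u ^ 2 := by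
      have : y ^ 2 * (1 - u) ^ 2 = (|y| * (1 - u)) ^ 2 := by rw [mul_pow, sq_abs]
      rw [this]
      have : 9 * η ^ 2 * u ^ 2 = (3 * η * u) ^ 2 := by ring
      rw [this]
      have : 0 ≤ |y| * (1 - u) := mul_nonneg (abs_nonneg _) (by linarith)
      gcongr
    have k1 : u * (1 + u) ^ 2 * (1 - u) ^ 2 ≤ 4 * u ^ 2 * (1 - u) ^ 2 + 9 * η ^ 2 * u ^ 2 * (1 + u) ^ 2 := by
      have a1 := mul_le_mul_of_nonneg_right hx (sq_nonneg (1 - u))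
      have a2 := mul_le_mul_of_nonneg_right hy (sq_nonneg (1 + u))
      calc u * (1 + u) ^ 2 * (1 - u) ^ 2 = (x ^ 2 + y ^ 2) * (1 + u) ^ 2 * (1 - u) ^ 2 := by rw [← hn2]
        _ = x ^ 2 * (1 + u) ^ 2 * (1 - u) ^ 2 + y ^ 2 * (1 - u) ^ 2 * (1 + u) ^ 2 := by ring
        _ ≤ _ := by linarith
    have k2 : u * ((1 - u) ^ 2) ^ 2 ≤ u * (9 * η ^ 2 * u * (1 + u) ^ 2) := by
      have : u * (1 + u) ^ 2 * (1 - u) ^ 2 - 4 * u ^ 2 * (1 - u) ^ 2 = u * ((1 - u) ^ 2) ^ 2 := by ring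
      linarith
    have k3 : ((1 - u) ^ 2) ^ 2 ≤ 9 * η ^ 2 * u * (1 + u) ^ 2 := le_of_mul_le_mul_left k2 hu0
    have k4 : 9 * η ^ 2 * u * (1 + u) ^ 2 ≤ (6 * η) ^ 2 := by
      have : u * (1 + u) ^ 2 ≤ 1 * (1 + 1) ^ 2 := by gcongr
      nlinarith [sq_nonneg η]
    have k5 : (1 - u) ^ 2 ≤ 6 * η := by
      apply le_of_sq_le_sq _ (by positivity)
      linarith
    have k6 : (1 / (2 * J : ℝ)) ^ 2 ≤ (1 - u) ^ 2 := by gcongr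
    have k7 : (1 / (2 * J : ℝ)) ^ 2 = 1 / (4 * J ^ 2) := by rw [div_pow, mul_pow]; norm_num
    linarith
  · intro ζ h1 h2
    rw [hΩn] at h2
    have hb := hbern _ (sq_nonneg _) h2
    have h3 := hybound ζ h1
    have hr1 := js_lt (hdom1 ζ h1)
    have hyy : |(js (ζ + η * I)).im| ≤ 6 * J * η := by
      have hu1 : ‖js (ζ + η * I)‖ ^ 2 ≤ 1 := by nlinarith [norm_nonneg (js (ζ + η * I))]
      have a1 : |(js (ζ + η * I)).im| * (1 / (2 * J)) ≤ 3 * η := by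
        calc _ ≤ |(js (ζ + η * I)).im| * (1 - ‖js (ζ + η * I)‖ ^ 2) := by gcongr
          _ ≤ _ := h3
          _ ≤ 3 * η * 1 := by gcongr
          _ = _ := by ring
      have : |(js (ζ + η * I)).im| = |(js (ζ + η * I)).im| * (1 / (2 * J)) * (2 * J) := by field_simp
      rw [this]
      calc _ ≤ 3 * η * (2 * J) := by gcongr
        _ = _ := by ring
    have e1 : ((‖js (ζ + η * I) ^ (2 * J)‖ : ℝ) : ℂ) = ((‖js (ζ + η * I)‖ ^ 2 : ℝ) : ℂ) ^ J := by
      rw [hΩn]; push_cast; rfl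
    rw [e1]
    simp only []
    rw [pow_mul]
    refine (norm_pow_sub_le _ _ ?_ ?_ J).trans ?_
    · rw [norm_pow]; exact pow_le_one₀ (norm_nonneg _) hr1.le
    · rw [Complex.norm_real, Real.norm_of_nonneg (sq_nonneg _)]
      exact pow_le_one₀ (norm_nonneg _) hr1.le
    · have e2 : js (ζ + η * I) ^ 2 - ((‖js (ζ + η * I)‖ ^ 2 : ℝ) : ℂ) =
          2 * ((js (ζ + η * I)).im * I) * js (ζ + η * I) := by
        rw [← Complex.normSq_eq_norm_sq]
        apply Complex.ext
        · simp [pow_two, Complex.normSq_apply]; ring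
        · simp [pow_two]; ring
      rw [e2]
      simp only [norm_mul, Complex.norm_real, Complex.norm_I, Real.norm_eq_abs]
      have : ‖(2:ℂ)‖ = 2 := by simp
      rw [this]
      calc (J:ℝ) * (2 * (|(js (ζ + η * I)).im| * 1) * ‖js (ζ + η * I)‖) ≤ J * (2 * (6 * J * η * 1) * 1) := by
            gcongr
        _ = 12 * J ^ 2 * η := by ring
        _ ≤ e := hη4
  · intro ζ h1 h2
    have h4 := (js_coords (hdom1 ζ h1)).2
    rw [hre] at h4
    have hr1 := js_lt (hdom1 ζ h1)
    have hr0 : 0 < ‖js (ζ + η * I)‖ := norm_pos_iff.2 (js_ne (hdom1 ζ h1))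
    have hxr := Complex.abs_re_le_norm (js (ζ + η * I))
    simp only [norm_pow]
    set r := ‖js (ζ + η * I)‖ with hr
    have a1 : 2 * (1 + κ') * r ^ 2 ≤ r * (r ^ 2 + 1) := by
      have : |(js (ζ + η * I)).re| * (r ^ 2 + 1) = 2 * |ζ.re| * r ^ 2 := by
        have := congrArg abs h4
        rw [abs_mul, abs_mul, abs_mul, abs_of_pos (by positivity : 0 < r ^ 2 + 1), abs_of_pos (by positivity : 0 < r ^ 2)] at this
        simpa using this
      calc _ ≤ 2 * |ζ.re| * r ^ 2 := by gcongr; linarith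
        _ = _ := this.symm
        _ ≤ _ := by gcongr
    have a2 : 2 * (1 + κ') * r ≤ r ^ 2 + 1 := by
      have : r * (2 * (1 + κ') * r) ≤ r * (r ^ 2 + 1) := by linarith
      exact le_of_mul_le_mul_left this hr0
    have a3 : r ≤ 1 - κ' := by
      by_contra hc
      push Not at hc
      nlinarith
    calc r ^ (2 * J) ≤ (1 - κ') ^ (2 * J) := by gcongr
      _ ≤ (1 - κ') ^ m := pow_le_pow_of_le_one (by linarith) (by linarith) (by omega)
      _ ≤ e / 4 := hm2
      _ ≤ e := by linarith

/-- Families of scalar peak functions attached to boundary points. -/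
structure ArcFam (D : Set ℂ) (e κ κs l : ℝ) (ω : ℂ → ℂ → ℂ) (E : ℂ → Bool → Set ℂ) : Prop where
  an : ∀ p ∈ frontier D, AnalyticOnNhd ℂ (ω p) (closure D)
  le1 : ∀ p ∈ frontier D, ∀ z ∈ closure D, ‖ω p z‖ ≤ 1
  tail : ∀ p ∈ frontier D, ∀ z ∈ closure D, 4 * l ≤ ‖z - p‖ → ‖ω p z‖ ≤ e / (‖z - p‖ / (2 * l)) ^ 3
  near : ∀ p ∈ frontier D, ∀ z ∈ frontier D, ‖z - p‖ ≤ 2 * l → 1 / 2 ≤ ‖ω p z‖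
  unif : ∀ p ∈ frontier D, ∀ z ∈ frontier D, ∀ z' ∈ frontier D, ‖z - p‖ ≤ 20 * l →
    ‖z' - p‖ ≤ 20 * l → ‖z - z'‖ ≤ κ * l → ‖ω p z - ω p z'‖ ≤ e
  cases : ∀ p ∈ frontier D, ∀ z ∈ frontier D, ‖z - p‖ ≤ 20 * l →
    1 / 2 ≤ ‖ω p z‖ ∨ ‖ω p z‖ ≤ e ∨ (‖ω p z - (‖ω p z‖ : ℂ)‖ ≤ e ∧ ∃ s, z ∈ E p s)
  Esub : ∀ p ∈ frontier D, ∀ s, E p s ⊆ frontier D ∩ closedBall p (20 * l)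
  Ediam : ∀ p ∈ frontier D, ∀ s, ∀ z ∈ E p s, ∀ z' ∈ E p s, ‖z - z'‖ ≤ κs * l

set_option maxHeartbeats 800000 in
lemma arcs (D : Set ℂ) (hDopen : IsOpen D) (hD : Bornology.IsBounded D)
    (hsb : SmoothlyBounded D) (e κs : ℝ) (he : 0 < e) (hκs : 0 < κs) :
    ∃ κ > 0, ∃ l0 > 0, ∀ l, 0 < l → l < l0 → ∃ ω E, ArcFam D e κ κs l ω E := by
  obtain ⟨θ, hθ, hθκ, Ω, Oa, Ob, Oc, Od, Oe, Of⟩ := scalar_fn e (κs / 6) he (by positivity)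
  obtain ⟨t0, ht0, hν⟩ := boundary_geom D hDopen hD hsb (θ / 10) (by positivity)
  choose! ν hν1 hν2 using hν
  set Z : Set ℂ := {ζ | -θ ≤ ζ.im} ∩ closedBall 0 10 with hZ
  have hZc : IsCompact Z := by
    apply IsCompact.inter_left (isCompact_closedBall _ _)
    exact isClosed_le continuous_const Complex.continuous_im
  have hZO : Z ⊆ {ζ | -(2 * θ) < ζ.im ∨ 3 / 2 < ‖ζ‖} := by
    rintro ζ ⟨h1, h2⟩
    left
    simp at h1
    linarith
  have huc := hZc.uniformContinuousOn_of_continuous (Oa.continuousOn.mono hZO)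
  obtain ⟨κ, hκ, hκ'⟩ := Metric.uniformContinuousOn_iff.1 huc e he
  have hOopen : IsOpen {ζ : ℂ | -(2 * θ) < ζ.im ∨ 3 / 2 < ‖ζ‖} :=
    (isOpen_lt continuous_const Complex.continuous_im).union
      (isOpen_lt continuous_const continuous_norm)
  refine ⟨κ, hκ, t0 / 20, by positivity, ?_⟩
  intro l hl hl0
  have hl20 : 20 * l ≤ t0 := by linarith
  let ζ : ℂ → ℂ → ℂ := fun p z => -I * ((z - p) * (starRingEnd ℂ) (ν p)) / ((2 * l : ℝ) : ℂ)
  have hζn : ∀ p ∈ frontier D, ∀ z, ‖ζ p z‖ = ‖z - p‖ / (2 * l) := by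
    intro p hp z
    simp only [ζ]
    rw [norm_div, norm_mul, norm_mul, Complex.norm_conj, hν1 p hp, Complex.norm_real,
      Real.norm_of_nonneg (by positivity)]
    simp
  have hζsub : ∀ p ∈ frontier D, ∀ z z', ‖ζ p z - ζ p z'‖ = ‖z - z'‖ / (2 * l) := by
    intro p hp z z'
    have : ζ p z - ζ p z' = -I * ((z - z') * (starRingEnd ℂ) (ν p)) / ((2 * l : ℝ) : ℂ) := by
      simp only [ζ]; ring
    rw [this, norm_div, norm_mul, norm_mul, Complex.norm_conj, hν1 p hp, Complex.norm_real,
      Real.norm_of_nonneg (by positivity)]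
    simp
  have hζim : ∀ p z, (ζ p z).im = -((z - p) * (starRingEnd ℂ) (ν p)).re / (2 * l) := by
    intro p z
    simp only [ζ]
    rw [Complex.div_ofReal_im]
    simp
  have him1 : ∀ p ∈ frontier D, ∀ z ∈ closure D, ‖z - p‖ ≤ 20 * l → -θ ≤ (ζ p z).im := by
    intro p hp z hz h
    have h1 := (hν2 p hp z (h.trans hl20)).1 hz
    rw [hζim, le_div_iff₀ (by positivity)]
    have : θ / 10 * ‖z - p‖ ≤ θ / 10 * (20 * l) := by gcongr
    linarith
  have him2 : ∀ p ∈ frontier D, ∀ z ∈ frontier D, ‖z - p‖ ≤ 20 * l → |(ζ p z).im| ≤ θ := by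
    intro p hp z hz h
    have h1 := (hν2 p hp z (h.trans hl20)).2 hz
    rw [hζim, abs_div, abs_neg, abs_of_pos (by positivity : 0 < 2 * l), div_le_iff₀ (by positivity)]
    have : θ / 10 * ‖z - p‖ ≤ θ / 10 * (20 * l) := by gcongr
    linarith
  have hO : ∀ p ∈ frontier D, ∀ z ∈ closure D, (-(2 * θ) < (ζ p z).im ∨ 3 / 2 < ‖ζ p z‖) := by
    intro p hp z hz
    by_cases h : ‖z - p‖ ≤ 20 * l
    · left; have := him1 p hp z hz h; linarith
    · right
      push Not at h
      rw [hζn p hp, lt_div_iff₀ (by positivity)]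
      linarith
  have hfc := frontier_subset_closure (s := D)
  refine ⟨fun p z => Ω (ζ p z), fun p s => {z | z ∈ frontier D ∧ ‖z - p‖ ≤ 20 * l ∧
    1 ≤ (if s then (ζ p z).re else -(ζ p z).re) ∧ (if s then (ζ p z).re else -(ζ p z).re) ≤ 1 + κs / 6},
    ?_, ?_, ?_, ?_, ?_, ?_, ?_, ?_⟩
  · intro p hp z hz
    have h1 : AnalyticAt ℂ Ω (ζ p z) := Oa.analyticAt (hOopen.mem_nhds (hO p hp z hz))
    have h2 : AnalyticAt ℂ (ζ p) z := by
      simp only [ζ]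
      fun_prop (disch := simp [hl.ne'])
    exact h1.comp h2
  · intro p hp z hz
    exact Ob _ (hO p hp z hz)
  · intro p hp z hz h
    rw [← hζn p hp]
    apply Oc
    rw [hζn p hp, le_div_iff₀ (by positivity)]
    linarith
  · intro p hp z hz h
    apply Od _ (him2 p hp z hz (by linarith))
    refine (Complex.abs_re_le_norm _).trans ?_
    rw [hζn p hp, div_le_iff₀ (by positivity)]
    linarith
  · intro p hp z hz z' hz' h h' hzz
    have hin : ∀ z ∈ frontier D, ‖z - p‖ ≤ 20 * l → ζ p z ∈ Z := by
      intro z hz h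
      refine ⟨him1 p hp z (hfc hz) h, ?_⟩
      rw [mem_closedBall_zero_iff, hζn p hp, div_le_iff₀ (by positivity)]
      linarith
    have := hκ' (ζ p z) (hin z hz h) (ζ p z') (hin z' hz' h') (by
      rw [dist_eq_norm, hζsub p hp, div_lt_iff₀ (by positivity)]
      have : 0 < κ * l := by positivity
      linarith)
    rw [dist_eq_norm] at this
    exact this.le
  · intro p hp z hz h
    have h1 := him2 p hp z hz h
    by_cases h2 : 1 / 2 ≤ ‖Ω (ζ p z)‖
    · exact Or.inl h2
    right
    push Not at h2
    by_cases h3 : 1 + κs / 6 ≤ |(ζ p z).re|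
    · left; exact Of _ h1 h3
    right
    push Not at h3
    refine ⟨Oe _ h1 h2, ?_⟩
    have h4 : 1 ≤ |(ζ p z).re| := by
      by_contra hc
      push Not at hc
      have := Od _ h1 hc.le
      linarith
    rcases abs_cases (ζ p z).re with ⟨h5, h6⟩ | ⟨h5, h6⟩
    · refine ⟨true, hz, h, ?_⟩
      rw [h5] at h3 h4
      simp only [if_true]
      exact ⟨h4, h3.le⟩
    · refine ⟨false, hz, h, ?_⟩
      rw [h5] at h3 h4
      simp only [Bool.false_eq_true, if_false]
      exact ⟨h4, h3.le⟩
  · rintro p hp s z ⟨h1, h2, -⟩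
    exact ⟨h1, by rwa [mem_closedBall, dist_eq_norm]⟩
  · rintro p hp s z ⟨h1, h2, h3, h4⟩ z' ⟨h1', h2', h3', h4'⟩
    have i1 := abs_le.1 (him2 p hp z h1 h2)
    have i2 := abs_le.1 (him2 p hp z' h1' h2')
    have hre : |(ζ p z - ζ p z').re| ≤ κs / 6 := by
      rw [sub_re, abs_le]
      cases s
      · simp only [Bool.false_eq_true, if_false] at h3 h4 h3' h4'
        constructor <;> linarith
      · simp only [if_true] at h3 h4 h3' h4'
        constructor <;> linarith
    have him : |(ζ p z - ζ p z').im| ≤ 2 * (κs / 6) := by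
      rw [sub_im, abs_le]
      constructor <;> linarith
    have := Complex.norm_le_abs_re_add_abs_im (ζ p z - ζ p z')
    rw [hζsub p hp, div_le_iff₀ (by positivity)] at this
    nlinarith

def cell (l : ℝ) (z : ℂ) : Fin 2 → ℤ := ![⌊z.re / l⌋, ⌊z.im / l⌋]
def colour (l : ℝ) (z : ℂ) : Fin 2 → ZMod 20 := fun i => (cell l z i : ZMod 20)

lemma floor_sub_le (a b : ℝ) : |((⌊a⌋ - ⌊b⌋ : ℤ) : ℝ)| ≤ |a - b| + 1 := by
  push_cast
  have h1 := Int.floor_le a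
  have h2 := Int.lt_floor_add_one a
  have h3 := Int.floor_le b
  have h4 := Int.lt_floor_add_one b
  have h5 := le_abs_self (a - b)
  have h6 := neg_abs_le (a - b)
  rw [abs_le]; constructor <;> linarith

lemma sub_le_floor (a b : ℝ) : |a - b| ≤ |((⌊a⌋ - ⌊b⌋ : ℤ) : ℝ)| + 1 := by
  push_cast
  have h1 := Int.floor_le a
  have h2 := Int.lt_floor_add_one a
  have h3 := Int.floor_le b
  have h4 := Int.lt_floor_add_one b
  have h5 := le_abs_self ((⌊a⌋ : ℝ) - ⌊b⌋)
  have h6 := neg_abs_le ((⌊a⌋ : ℝ) - ⌊b⌋)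
  rw [abs_le]; constructor <;> linarith

lemma floor_close (a b : ℝ) (h : |a - b| ≤ 1) : |((⌊a⌋ - ⌊b⌋ : ℤ) : ℝ)| ≤ 1 := by
  have h' := abs_le.1 h
  have h1 := Int.floor_le a
  have h2 := Int.lt_floor_add_one a
  have h3 := Int.floor_le b
  have h4 := Int.lt_floor_add_one b
  have k1 : ⌊a⌋ - ⌊b⌋ < 2 := by
    have : ((⌊a⌋ - ⌊b⌋ : ℤ) : ℝ) < 2 := by push_cast; linarith
    exact_mod_cast this
  have k2 : -2 < ⌊a⌋ - ⌊b⌋ := by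
    have : (-2 : ℝ) < ((⌊a⌋ - ⌊b⌋ : ℤ) : ℝ) := by push_cast; linarith
    exact_mod_cast this
  have : |⌊a⌋ - ⌊b⌋| ≤ 1 := by rw [abs_le]; omega
  exact_mod_cast this

lemma cell_norm_le {l : ℝ} {z p : ℂ} {r : ℝ} (hr : 0 ≤ r)
    (h0 : |((⌊z.re / l⌋ - ⌊p.re / l⌋ : ℤ) : ℝ)| ≤ r) (h1 : |((⌊z.im / l⌋ - ⌊p.im / l⌋ : ℤ) : ℝ)| ≤ r) :
    ‖cell l z - cell l p‖ ≤ r := by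
  rw [pi_norm_le_iff_of_nonneg hr]
  intro i
  rw [Int.norm_eq_abs]
  fin_cases i
  · exact h0
  · exact h1

lemma cell_re {l : ℝ} (z p : ℂ) : |((⌊z.re / l⌋ - ⌊p.re / l⌋ : ℤ) : ℝ)| ≤ ‖cell l z - cell l p‖ := by
  have := norm_le_pi_norm (cell l z - cell l p) 0
  rw [Int.norm_eq_abs] at this
  exact this

lemma cell_im {l : ℝ} (z p : ℂ) : |((⌊z.im / l⌋ - ⌊p.im / l⌋ : ℤ) : ℝ)| ≤ ‖cell l z - cell l p‖ := by
  have := norm_le_pi_norm (cell l z - cell l p) 1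
  rw [Int.norm_eq_abs] at this
  exact this

lemma re_div_le {l : ℝ} (hl : 0 < l) (z p : ℂ) : |z.re / l - p.re / l| ≤ ‖z - p‖ / l := by
  rw [← sub_div, abs_div, abs_of_pos hl]
  gcongr
  exact Complex.abs_re_le_norm (z - p)

lemma im_div_le {l : ℝ} (hl : 0 < l) (z p : ℂ) : |z.im / l - p.im / l| ≤ ‖z - p‖ / l := by
  rw [← sub_div, abs_div, abs_of_pos hl]
  gcongr
  exact Complex.abs_im_le_norm (z - p)

lemma cell_close {l : ℝ} (hl : 0 < l) {z p : ℂ} (h : ‖z - p‖ ≤ l) : ‖cell l z - cell l p‖ ≤ 1 := by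
  have : ‖z - p‖ / l ≤ 1 := by rwa [div_le_one hl]
  exact cell_norm_le zero_le_one (floor_close _ _ ((re_div_le hl z p).trans this))
    (floor_close _ _ ((im_div_le hl z p).trans this))

lemma cell_le {l : ℝ} (hl : 0 < l) (z p : ℂ) : ‖cell l z - cell l p‖ ≤ ‖z - p‖ / l + 1 :=
  cell_norm_le (by positivity) ((floor_sub_le _ _).trans (by linarith [re_div_le hl z p]))
    ((floor_sub_le _ _).trans (by linarith [im_div_le hl z p]))

lemma le_cell {l : ℝ} (hl : 0 < l) (z p : ℂ) : ‖z - p‖ ≤ 2 * (‖cell l z - cell l p‖ + 1) * l := by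
  have h1 : |(z - p).re| ≤ (‖cell l z - cell l p‖ + 1) * l := by
    have := (sub_le_floor (z.re / l) (p.re / l)).trans (add_le_add_left (cell_re z p) 1)
    rw [← sub_div, abs_div, abs_of_pos hl, div_le_iff₀ hl] at this
    exact this
  have h2 : |(z - p).im| ≤ (‖cell l z - cell l p‖ + 1) * l := by
    have := (sub_le_floor (z.im / l) (p.im / l)).trans (add_le_add_left (cell_im z p) 1)
    rw [← sub_div, abs_div, abs_of_pos hl, div_le_iff₀ hl] at this
    exact this
  have := Complex.norm_le_abs_re_add_abs_im (z - p)
  linarith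

lemma cell_eq_of_colour {l : ℝ} {p p' : ℂ} (hc : colour l p = colour l p')
    (h : ‖cell l p - cell l p'‖ ≤ 18) : cell l p = cell l p' := by
  funext i
  have h1 := congrFun hc i
  simp only [colour] at h1
  rw [ZMod.intCast_eq_intCast_iff_dvd_sub] at h1
  have h2 := (norm_le_pi_norm (cell l p - cell l p') i).trans h
  rw [Int.norm_eq_abs] at h2
  have h3 : |cell l p i - cell l p' i| ≤ 18 := by exact_mod_cast h2
  rw [abs_le] at h3
  push_cast at h1
  omega

lemma lattice_sum : ∃ S > 0, ∀ J : Finset (Fin 2 → ℤ), ∑ c ∈ J, 1 / ‖c‖ ^ 3 ≤ S := by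
  have hs := EisensteinSeries.summable_one_div_norm_rpow (k := 3) (by norm_num)
  refine ⟨∑' x : Fin 2 → ℤ, ‖x‖ ^ (-3 : ℝ) + 1, ?_, ?_⟩
  · have : 0 ≤ ∑' x : Fin 2 → ℤ, ‖x‖ ^ (-3 : ℝ) := tsum_nonneg fun _ => by positivity
    linarith
  · intro J
    have h1 := hs.sum_le_tsum J (fun _ _ => by positivity)
    have h2 : ∑ c ∈ J, 1 / ‖c‖ ^ 3 = ∑ c ∈ J, ‖c‖ ^ (-3 : ℝ) := by
      apply Finset.sum_congr rfl
      intro c _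
      rw [Real.rpow_neg (norm_nonneg _), one_div]
      norm_cast
    rw [h2]
    linarith

lemma reps (l : ℝ) (hl : 0 < l) (T : Set ℂ) (hT : Bornology.IsBounded T) (γ : Fin 2 → ZMod 20) :
    ∃ J : Finset ℂ, (∀ p ∈ J, p ∈ T) ∧ Set.InjOn (cell l) (J : Set ℂ) ∧ (∀ p ∈ J, colour l p = γ) ∧
      ∀ z ∈ T, colour l z = γ → ∃ p ∈ J, cell l p = cell l z := by
  obtain ⟨s, hs, hb⟩ := Set.exists_subset_bijOn (T ∩ {z | colour l z = γ}) (cell l)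
  have hfin : (cell l '' (T ∩ {z | colour l z = γ})).Finite := by
    obtain ⟨B, hB⟩ := hT.exists_norm_le
    refine (Set.finite_Icc (fun _ : Fin 2 => -(⌈B / l⌉ + 1)) (fun _ => ⌈B / l⌉ + 1)).subset ?_
    rintro _ ⟨z, ⟨hz, -⟩, rfl⟩
    have h := hB z hz
    have key : ∀ x : ℝ, |x| ≤ ‖z‖ → -(⌈B / l⌉ + 1) ≤ ⌊x / l⌋ ∧ ⌊x / l⌋ ≤ ⌈B / l⌉ + 1 := by
      intro x hx
      have h1 : |x / l| ≤ B / l := by rw [abs_div, abs_of_pos hl]; gcongr; linarith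
      have h2 := abs_le.1 h1
      have h3 := Int.le_ceil (B / l)
      constructor
      · rw [Int.le_floor]; push_cast; linarith
      · have := Int.floor_le (x / l)
        have : ((⌊x / l⌋ : ℤ) : ℝ) ≤ ((⌈B / l⌉ + 1 : ℤ) : ℝ) := by push_cast; linarith
        exact_mod_cast this
    have k0 := key z.re (Complex.abs_re_le_norm z)
    have k1 := key z.im (Complex.abs_im_le_norm z)
    constructor
    · intro i; fin_cases i
      · exact k0.1
      · exact k1.1
    · intro i; fin_cases i
      · exact k0.2
      · exact k1.2
  have hsf : s.Finite := hb.finite_iff_finite.2 hfin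
  refine ⟨hsf.toFinset, ?_, ?_, ?_, ?_⟩
  · intro p hp; exact (hs (hsf.mem_toFinset.1 hp)).1
  · rw [hsf.coe_toFinset]; exact hb.injOn
  · intro p hp; exact (hs (hsf.mem_toFinset.1 hp)).2
  · intro z hz hzc
    obtain ⟨p, hp, hpz⟩ := hb.surjOn ⟨z, ⟨hz, hzc⟩, rfl⟩
    exact ⟨p, hsf.mem_toFinset.2 hp, hpz⟩

lemma tail_sum {F : Type*} [NormedAddCommGroup F] {S : ℝ}
    (hS : ∀ J : Finset (Fin 2 → ℤ), ∑ c ∈ J, 1 / ‖c‖ ^ 3 ≤ S) {l : ℝ} (hl : 0 < l)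
    (J : Finset ℂ) (hJ : Set.InjOn (cell l) (J : Set ℂ)) (G : ℂ → F) (A : ℝ) (hA : 0 ≤ A) (z : ℂ)
    (hG : ∀ p ∈ J, 4 * l ≤ ‖z - p‖ → ‖G p‖ ≤ A / (‖z - p‖ / (2 * l)) ^ 3)
    (hfar : ∀ p ∈ J, 8 ≤ ‖cell l z - cell l p‖) : ‖∑ p ∈ J, G p‖ ≤ 64 * A * S := by
  refine (norm_sum_le _ _).trans ?_
  have h1 : ∀ p ∈ J, ‖G p‖ ≤ 64 * A * (1 / ‖cell l z - cell l p‖ ^ 3) := by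
    intro p hp
    have h8 := hfar p hp
    have h2 := cell_le hl z p
    set n := ‖cell l z - cell l p‖
    have h3 : (n / 2) * l ≤ ‖z - p‖ := by
      have : n - 1 ≤ ‖z - p‖ / l := by linarith
      rw [le_div_iff₀ hl] at this
      nlinarith
    have h4 : 4 * l ≤ ‖z - p‖ := by nlinarith
    refine (hG p hp h4).trans ?_
    have h5 : n / 4 ≤ ‖z - p‖ / (2 * l) := by
      rw [le_div_iff₀ (by positivity)]; linarith
    have hn : 0 < n / 4 := by linarith
    calc A / (‖z - p‖ / (2 * l)) ^ 3 ≤ A / (n / 4) ^ 3 := by gcongr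
      _ = _ := by
        have : n ≠ 0 := by linarith
        field_simp; norm_num
  refine (Finset.sum_le_sum h1).trans ?_
  rw [← Finset.mul_sum]
  apply mul_le_mul_of_nonneg_left _ (by positivity)
  have h2 : ∑ p ∈ J, 1 / ‖cell l z - cell l p‖ ^ 3 =
      ∑ c ∈ J.image (fun p => cell l z - cell l p), 1 / ‖c‖ ^ 3 := by
    rw [Finset.sum_image]
    intro p hp p' hp' h
    exact hJ hp hp' (sub_right_injective h)
  rw [h2]
  exact hS _

lemma sum_near {F : Type*} [NormedAddCommGroup F] {S : ℝ}
    (hS : ∀ J : Finset (Fin 2 → ℤ), ∑ c ∈ J, 1 / ‖c‖ ^ 3 ≤ S) {l : ℝ} (hl : 0 < l)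
    (J : Finset ℂ) (hJ : Set.InjOn (cell l) (J : Set ℂ)) (γ : Fin 2 → ZMod 20)
    (hJc : ∀ p ∈ J, colour l p = γ) (G : ℂ → ℂ → F) (A : ℝ) (hA : 0 ≤ A) (Z : Set ℂ)
    (hG : ∀ p ∈ J, ∀ z ∈ Z, 4 * l ≤ ‖z - p‖ → ‖G p z‖ ≤ A / (‖z - p‖ / (2 * l)) ^ 3) (z : ℂ) :
    ((∀ p ∈ J, cell l p ≠ cell l z) ∧ ∀ z' ∈ Z, ‖z' - z‖ ≤ l → ‖∑ p ∈ J, G p z'‖ ≤ 64 * A * S) ∨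
    ∃ p ∈ J, (∀ p' ∈ J, cell l p' = cell l z → p' = p) ∧ ∀ z' ∈ Z, ‖z' - z‖ ≤ l →
      ‖z' - p‖ ≤ 20 * l ∧ ‖∑ p' ∈ J, G p' z' - G p z'‖ ≤ 64 * A * S := by
  have tri : ∀ z' p, ‖z' - z‖ ≤ l → ‖cell l z - cell l p‖ - 1 ≤ ‖cell l z' - cell l p‖ ∧
      ‖cell l z' - cell l p‖ ≤ ‖cell l z - cell l p‖ + 1 := by
    intro z' p h
    have h1 := cell_close hl h
    have h2 := norm_sub_le_norm_sub_add_norm_sub (cell l z') (cell l z) (cell l p)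
    have h3 := norm_sub_le_norm_sub_add_norm_sub (cell l z) (cell l z') (cell l p)
    rw [norm_sub_rev (cell l z) (cell l z')] at h3
    constructor <;> linarith
  by_cases h : ∃ p ∈ J, ‖cell l z - cell l p‖ < 9
  · right
    obtain ⟨p, hp, hpn⟩ := h
    have huniq : ∀ p' ∈ J, ‖cell l z - cell l p'‖ < 9 → p' = p := by
      intro p' hp' hn
      apply hJ hp' hp
      apply cell_eq_of_colour ((hJc p' hp').trans (hJc p hp).symm)
      have := norm_sub_le_norm_sub_add_norm_sub (cell l p') (cell l z) (cell l p)
      rw [norm_sub_rev (cell l p') (cell l z)] at this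
      linarith
    refine ⟨p, hp, fun p' hp' he => huniq p' hp' (by rw [he]; simp), ?_⟩
    intro z' hz' hzz
    constructor
    · have h1 := le_cell hl z' p
      have h2 := (tri z' p hzz).2
      have hinteq : ‖cell l z - cell l p‖ ≤ 8 := by
        rw [pi_norm_le_iff_of_nonneg (by norm_num)]
        intro i
        have := (norm_le_pi_norm (cell l z - cell l p) i).trans_lt hpn
        rw [Int.norm_eq_abs] at this ⊢
        have h9 : |(cell l z - cell l p) i| < 9 := by exact_mod_cast this
        have : |(cell l z - cell l p) i| ≤ 8 := by omega
        exact_mod_cast this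
      nlinarith
    · rw [← Finset.add_sum_erase J (fun p' => G p' z') hp, add_sub_cancel_left]
      apply tail_sum hS hl (J.erase p) (hJ.mono (by simp)) (fun p' => G p' z') A hA z'
      · intro p' hp'; exact hG p' (Finset.mem_of_mem_erase hp') z' hz'
      · intro p' hp'
        have h1 : 9 ≤ ‖cell l z - cell l p'‖ := by
          by_contra hc
          push Not at hc
          exact Finset.ne_of_mem_erase hp' (huniq p' (Finset.mem_of_mem_erase hp') hc)
        have := (tri z' p' hzz).1
        linarith
  · left
    push Not at h
    refine ⟨fun p hp he => ?_, ?_⟩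
    · have := h p hp
      rw [he] at this; simp at this; linarith
    · intro z' hz' hzz
      apply tail_sum hS hl J hJ (fun p' => G p' z') A hA z'
      · intro p' hp'; exact hG p' hp' z' hz'
      · intro p' hp'
        have := (tri z' p' hzz).1
        have := h p' hp'
        linarith

lemma two_half (a b : ℂ) : ∃ c : ℂ, ‖c‖ = 1 ∧ 0 ≤ (c * a).re ∧ 0 ≤ (c * b).re := by
  have one : ∀ b : ℂ, ∃ c : ℂ, ‖c‖ = 1 ∧ 0 ≤ (c * b).re := by
    intro b
    rcases le_total 0 b.re with h | h
    · exact ⟨1, by simp, by simpa using h⟩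
    · exact ⟨-1, by simp, by simpa using h⟩
  by_cases ha : a = 0
  · obtain ⟨c, h1, h2⟩ := one b
    exact ⟨c, h1, by simp [ha], h2⟩
  have han : 0 < ‖a‖ := norm_pos_iff.2 ha
  set d : ℂ := I * (starRingEnd ℂ) a / ‖a‖ with hd
  have hd1 : ‖d‖ = 1 := by
    rw [hd, norm_div, norm_mul, Complex.norm_conj]
    simp [han.ne']
  have hda : (d * a).re = 0 := by
    have : d * a = I * ((‖a‖ : ℝ) : ℂ) := by
      have h0 : ((‖a‖ : ℝ) : ℂ) ≠ 0 := by exact_mod_cast han.ne'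
      rw [hd]
      have h1 : (starRingEnd ℂ) a * a = ((‖a‖ : ℝ) : ℂ) ^ 2 := by
        rw [mul_comm, Complex.mul_conj, Complex.normSq_eq_norm_sq]; push_cast; rfl
      calc I * (starRingEnd ℂ) a / ‖a‖ * a = I * ((starRingEnd ℂ) a * a) / ‖a‖ := by ring
        _ = _ := by rw [h1]; field_simp
    rw [this]; simp
  rcases le_total 0 (d * b).re with h | h
  · exact ⟨d, hd1, hda.ge, h⟩
  · refine ⟨-d, by simpa using hd1, by rw [neg_mul, neg_re, hda]; simp, ?_⟩
    rw [neg_mul, neg_re]; linarith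

def ud {N : ℕ} (v w : Cn N) (l : ℂ) : Cn N := l • v + l ^ 2 • w

lemma ud_norm {N : ℕ} (v w : Cn N) (l : ℂ) (hl : ‖l‖ ≤ 1) : ‖ud v w l‖ ≤ (‖v‖ + ‖w‖) * ‖l‖ := by
  unfold ud
  refine (norm_add_le _ _).trans ?_
  rw [norm_smul, norm_smul, norm_pow]
  have : ‖l‖ ^ 2 ≤ ‖l‖ := by nlinarith [norm_nonneg l]
  have := mul_le_mul_of_nonneg_right this (norm_nonneg w)
  linarith

lemma ud_sub {N : ℕ} (v w : Cn N) (l l' : ℂ) (hl : ‖l‖ ≤ 1) (hl' : ‖l'‖ ≤ 1) :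
    ‖ud v w l - ud v w l'‖ ≤ 2 * (‖v‖ + ‖w‖) * ‖l - l'‖ := by
  have : ud v w l - ud v w l' = (l - l') • v + ((l - l') * (l + l')) • w := by
    unfold ud
    rw [show (l - l') * (l + l') = l ^ 2 - l' ^ 2 by ring, sub_smul, sub_smul]; abel
  rw [this]
  refine (norm_add_le _ _).trans ?_
  rw [norm_smul, norm_smul, norm_mul]
  have h1 : ‖l + l'‖ ≤ 2 := (norm_add_le _ _).trans (by linarith)
  have h2 : ‖l - l'‖ * ‖l + l'‖ * ‖w‖ ≤ ‖l - l'‖ * 2 * ‖w‖ := by gcongr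
  nlinarith [mul_nonneg (norm_nonneg (l - l')) (norm_nonneg v)]

set_option maxHeartbeats 1600000 in
lemma round_fixed {N : ℕ} (ρ : Cn N → ℝ) (D : Set ℂ) (hD : Bornology.IsBounded D) {S : ℝ} (hS0 : 0 < S)
    (hS : ∀ J : Finset (Fin 2 → ℤ), ∑ c ∈ J, 1 / ‖c‖ ^ 3 ≤ S)
    {e κ κs l : ℝ} (hl : 0 < l) (he : 0 < e) (hκ1 : κ ≤ 1)
    {ω : ℂ → ℂ → ℂ} {E : ℂ → Bool → Set ℂ} (hA : ArcFam D e κ κs l ω E)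
    (T : Set ℂ) (hT : T ⊆ frontier D) (γ : Fin 2 → ZMod 20) (Q : ℂ → ℂ) (B : ℝ) (hB0 : 0 ≤ B)
    (hB : ∀ z ∈ closure D, ∀ p ∈ frontier D, ‖Q z * (Q p)⁻¹‖ ≤ B)
    (hQ1 : ∀ z ∈ closure D, ∀ p ∈ frontier D, ‖z - p‖ ≤ 20 * l → ‖Q z * (Q p)⁻¹ - 1‖ ≤ e)
    (R : ℝ) (hR1 : R ≤ 1) (η δ : ℝ) (g0 : ℂ → Cn N)
    (hvw : ∀ p ∈ frontier D, ∃ v w : Cn N, ‖v‖ + ‖w‖ ≤ R ∧ DiscProp ρ η δ (g0 p) v w)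
    (y : ℂ → Cn N)
    (hy : ∀ z ∈ frontier D, ∀ p ∈ frontier D, ‖z - p‖ ≤ 20 * l → ‖y z - g0 p‖ ≤ η)
    (τ1 : ℝ) (hτ1 : 0 ≤ τ1)
    (hymod : ∀ z ∈ frontier D, ∀ z' ∈ frontier D, ‖z - z'‖ ≤ κs * l → ‖y z - y z'‖ ≤ τ1) :
    ∃ Φ : ℂ → Cn N, AnalyticOnNhd ℂ Φ (closure D) ∧
      (∀ z ∈ closure D, ‖Q z • Φ z‖ ≤ R + (64 * B * S + 4) * e) ∧
      (∀ z ∈ frontier D, ∀ z' ∈ frontier D, ‖z - z'‖ ≤ κ * l →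
        ‖Q z • Φ z - Q z' • Φ z'‖ ≤ 2 * ((64 * B * S + 4) * e)) ∧
      (∀ z ∈ closure D, (∀ p ∈ T, 20 * l < ‖z - p‖) → ‖Q z • Φ z‖ ≤ (64 * B * S + 4) * e) ∧
      (∀ z ∈ frontier D,
        (∃ u, ‖Q z • Φ z - u‖ ≤ (64 * B * S + 4) * e ∧ ‖u‖ ≤ R ∧ ρ (y z) + δ ≤ ρ (y z + u)) ∨
        (¬ (z ∈ T ∧ colour l z = γ) ∧ ∃ u, ∃ z' ∈ frontier D, ‖Q z • Φ z - u‖ ≤ (64 * B * S + 4) * e ∧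
          ‖u‖ ≤ R ∧ ‖y z' - y z‖ ≤ τ1 ∧ ρ (y z') ≤ ρ (y z' + u))) := by
  have hfc := frontier_subset_closure (s := D)
  choose! v w hvwR hdisc using hvw
  have hcE : ∀ p ∈ frontier D, ∃ c : ℂ, ‖c‖ = 1 ∧ ∀ s, (E p s).Nonempty → ∃ z' ∈ E p s,
      ∀ t : ℝ, 0 ≤ t → t ≤ 1 → ρ (y z') ≤ ρ (y z' + ud (v p) (w p) (c * t)) := by
    intro p hp
    have h1 : ∀ s, ∃ a : ℂ, (E p s).Nonempty → ∃ z' ∈ E p s, ∀ l : ℂ, ‖l‖ ≤ 1 → 0 ≤ (l * a).re →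
        ρ (y z') ≤ ρ (y z' + (l • v p + l ^ 2 • w p)) := by
      intro s
      by_cases hs : (E p s).Nonempty
      · obtain ⟨z', hz'⟩ := hs
        have h2 := hA.Esub p hp s hz'
        obtain ⟨a, ha, -⟩ := hdisc p hp (y z') (hy z' h2.1 p hp (by
          have := h2.2; rwa [mem_closedBall, dist_eq_norm] at this))
        exact ⟨a, fun _ => ⟨z', hz', ha⟩⟩
      · exact ⟨0, fun h => absurd h hs⟩
    choose a ha using h1
    obtain ⟨c, hc1, hct, hcf⟩ := two_half (a true) (a false)
    refine ⟨c, hc1, fun s hs => ?_⟩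
    obtain ⟨z', hz', h⟩ := ha s hs
    refine ⟨z', hz', fun t ht0 ht1 => h _ ?_ ?_⟩
    · rw [norm_mul, hc1, Complex.norm_real, Real.norm_of_nonneg ht0]; linarith
    · have : c * t * a s = t * (c * a s) := by ring
      rw [this, Complex.re_ofReal_mul]
      apply mul_nonneg ht0
      cases s
      · exact hcf
      · exact hct
  choose! c hc1 hc using hcE
  obtain ⟨J, hJT, hJinj, hJc, hJrep⟩ := reps l hl T ((hD.closure.subset hfc).subset hT) γ
  have hJf : ∀ p ∈ J, p ∈ frontier D := fun p hp => hT (hJT p hp)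
  set U : ℂ → ℂ → Cn N := fun p z => ud (v p) (w p) (c p * ω p z) with hU
  set G : ℂ → ℂ → Cn N := fun p z => (Q z * (Q p)⁻¹) • U p z with hG
  have hcω : ∀ p ∈ frontier D, ∀ z, ‖c p * ω p z‖ = ‖ω p z‖ := by
    intro p hp z; rw [norm_mul, hc1 p hp, one_mul]
  have hUn : ∀ p ∈ frontier D, ∀ z ∈ closure D, ‖U p z‖ ≤ R * ‖ω p z‖ := by
    intro p hp z hz
    refine (ud_norm _ _ _ (by rw [hcω p hp]; exact hA.le1 p hp z hz)).trans ?_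
    rw [hcω p hp]
    gcongr
    exact hvwR p hp
  have hR0 : ∀ p ∈ frontier D, 0 ≤ R := fun p hp =>
    (add_nonneg (norm_nonneg _) (norm_nonneg _)).trans (hvwR p hp)
  have hUR : ∀ p ∈ frontier D, ∀ z ∈ closure D, ‖U p z‖ ≤ R := by
    intro p hp z hz
    refine (hUn p hp z hz).trans ?_
    have := hA.le1 p hp z hz
    nlinarith [hR0 p hp]
  have hGtail : ∀ p ∈ J, ∀ z ∈ closure D, 4 * l ≤ ‖z - p‖ → ‖G p z‖ ≤ (B * e) / (‖z - p‖ / (2 * l)) ^ 3 := by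
    intro p hp z hz h
    have hp' := hJf p hp
    have h1 := hA.tail p hp' z hz h
    have h2 := hUn p hp' z hz
    have h3 : R * ‖ω p z‖ ≤ 1 * ‖ω p z‖ := by gcongr
    calc ‖G p z‖ = ‖Q z * (Q p)⁻¹‖ * ‖U p z‖ := by simp only [hG]; rw [norm_smul]
      _ ≤ B * (e / (‖z - p‖ / (2 * l)) ^ 3) := by
        apply mul_le_mul (hB z hz p hp') (by linarith) (norm_nonneg _) hB0
      _ = _ := by ring
  have hGU : ∀ p ∈ frontier D, ∀ z ∈ closure D, ‖z - p‖ ≤ 20 * l → ‖G p z - U p z‖ ≤ e := by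
    intro p hp z hz h
    have : G p z - U p z = (Q z * (Q p)⁻¹ - 1) • U p z := by simp only [hG]; rw [sub_smul, one_smul]
    rw [this, norm_smul]
    calc _ ≤ e * 1 := by
          apply mul_le_mul (hQ1 z hz p hp h) ((hUR p hp z hz).trans hR1) (norm_nonneg _) he.le
      _ = e := mul_one _
  have main := sum_near hS hl J hJinj γ hJc G (B * e) (by positivity) (closure D) hGtail
  have hΦ : ∀ z, Q z • (∑ p ∈ J, (Q p)⁻¹ • U p z) = ∑ p ∈ J, G p z := by
    intro z
    rw [Finset.smul_sum]
    apply Finset.sum_congr rfl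
    intro p _
    simp only [hG]
    rw [smul_smul]
  have hC1 : 64 * (B * e) * S ≤ (64 * B * S + 4) * e := by nlinarith
  have hC2 : 64 * (B * e) * S + 3 * e ≤ (64 * B * S + 4) * e := by nlinarith
  have hlz : ∀ z : ℂ, ‖z - z‖ ≤ l := fun z => by simpa using hl.le
  refine ⟨fun z => ∑ p ∈ J, (Q p)⁻¹ • U p z, ?_, ?_, ?_, ?_, ?_⟩
  · apply Finset.analyticOnNhd_fun_sum
    intro p hp
    have h1 := hA.an p (hJf p hp)
    intro z hz
    have h2 := h1 z hz
    simp only [hU, ud]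
    fun_prop
  · intro z hz
    have hCe : 0 ≤ (64 * B * S + 4) * e := by positivity
    rw [hΦ]
    rcases main z with ⟨-, h⟩ | ⟨p, hp, -, h⟩
    · have := h z hz (hlz z)
      by_cases hJe : J.Nonempty
      · obtain ⟨p, hp⟩ := hJe
        have := hR0 p (hJf p hp)
        linarith
      · rw [Finset.not_nonempty_iff_eq_empty] at hJe
        obtain ⟨p, hp⟩ | hne := (frontier D).eq_empty_or_nonempty.symm
        · have := hR0 p hp
          linarith
        · exfalso
          have : frontier D = ∅ := hne
          have hDc : IsClopen D := isClopen_iff_frontier_eq_empty.2 this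
          rcases isClopen_iff.1 hDc with h0 | h0
          · rw [h0] at hz; simp at hz
          · rw [h0] at hD
            exact NormedSpace.unbounded_univ ℂ ℂ hD
    · obtain ⟨h1, h2⟩ := h z hz (hlz z)
      have h3 := hGU p (hJf p hp) z hz h1
      have h4 := hUR p (hJf p hp) z hz
      have h5 : ∑ p ∈ J, G p z = (∑ p' ∈ J, G p' z - G p z) + (G p z - U p z) + U p z := by abel
      rw [h5]
      refine (norm_add₃_le).trans ?_
      linarith
  · intro z hz z' hz' hzz
    simp only [hΦ]
    have hzz' : ‖z' - z‖ ≤ l := by rw [norm_sub_rev]; nlinarith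
    rcases main z with ⟨-, h⟩ | ⟨p, hp, -, h⟩
    · refine (norm_sub_le _ _).trans ?_
      have h1 := h z (hfc hz) (hlz z)
      have h2 := h z' (hfc hz') hzz'
      linarith
    · obtain ⟨h1, h2⟩ := h z (hfc hz) (hlz z)
      obtain ⟨h1', h2'⟩ := h z' (hfc hz') hzz'
      have hpf := hJf p hp
      have h3 := hGU p hpf z (hfc hz) h1
      have h3' := hGU p hpf z' (hfc hz') h1'
      have h4 : ‖U p z - U p z'‖ ≤ 2 * e := by
        refine (ud_sub _ _ _ _ (by rw [hcω p hpf]; exact hA.le1 p hpf z (hfc hz))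
          (by rw [hcω p hpf]; exact hA.le1 p hpf z' (hfc hz'))).trans ?_
        rw [← mul_sub, norm_mul, hc1 p hpf, one_mul]
        have h5 := hA.unif p hpf z hz z' hz' h1 h1' hzz
        have h6 := (hvwR p hpf).trans hR1
        calc _ ≤ 2 * 1 * e := by gcongr
          _ = _ := by ring
      have h5 : ∑ p ∈ J, G p z - ∑ p ∈ J, G p z' = (∑ p' ∈ J, G p' z - G p z) -
          (∑ p' ∈ J, G p' z' - G p z') + ((G p z - U p z) - (G p z' - U p z')) + (U p z - U p z') := by abel
      rw [h5]
      refine (norm_add₃_le).trans ?_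
      have h6 := norm_sub_le (∑ p' ∈ J, G p' z - G p z) (∑ p' ∈ J, G p' z' - G p z')
      have h7 := norm_sub_le (G p z - U p z) (G p z' - U p z')
      linarith
  · intro z hz hfar
    rw [hΦ]
    rcases main z with ⟨-, h⟩ | ⟨p, hp, -, h⟩
    · exact (h z hz (hlz z)).trans hC1
    · have := (h z hz (hlz z)).1
      have := hfar p (hJT p hp)
      linarith
  · intro z hz
    rw [hΦ]
    rcases main z with ⟨hne, h⟩ | ⟨p, hp, huniq, h⟩
    · right
      refine ⟨?_, 0, z, hz, ?_, ?_, by simpa using hτ1, by simp⟩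
      · rintro ⟨hzT, hzc⟩
        obtain ⟨p, hp, hpc⟩ := hJrep z hzT hzc
        exact hne p hp hpc
      · rw [sub_zero]; exact (h z (hfc hz) (hlz z)).trans hC1
      · rw [norm_zero]; exact hR0 z hz
    · obtain ⟨h1, h2⟩ := h z (hfc hz) (hlz z)
      have hpf := hJf p hp
      have h3 := hGU p hpf z (hfc hz) h1
      have h5 : ∀ u, ‖U p z - u‖ ≤ 2 * e → ‖∑ p ∈ J, G p z - u‖ ≤ (64 * B * S + 4) * e := by
        intro u hu
        have h5 : ∑ p ∈ J, G p z - u = (∑ p' ∈ J, G p' z - G p z) + (G p z - U p z) + (U p z - u) := by abel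
        rw [h5]
        refine (norm_add₃_le).trans ?_
        linarith
      by_cases hbig : 1 / 2 ≤ ‖ω p z‖
      · left
        refine ⟨U p z, h5 _ (by simpa using he.le), hUR p hpf z (hfc hz), ?_⟩
        obtain ⟨a, -, ha⟩ := hdisc p hpf (y z) (hy z hz p hpf h1)
        exact ha _ (by rw [hcω p hpf]; exact hbig) (by rw [hcω p hpf]; exact hA.le1 p hpf z (hfc hz))
      · right
        refine ⟨?_, ?_⟩
        · rintro ⟨hzT, hzc⟩
          obtain ⟨p', hp', hpc⟩ := hJrep z hzT hzc
          rw [huniq p' hp' hpc] at hpc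
          apply hbig
          apply hA.near p hpf z hz
          have := le_cell hl z p
          rw [hpc] at this
          simpa using this
        · rcases hA.cases p hpf z hz h1 with hc' | hc' | ⟨hc', s, hs⟩
          · exact absurd hc' hbig
          · refine ⟨0, z, hz, h5 _ ?_, by rw [norm_zero]; exact hR0 z hz, by simpa using hτ1, by simp⟩
            rw [sub_zero]
            have := hUn p hpf z (hfc hz)
            have h6 : R * ‖ω p z‖ ≤ 1 * ‖ω p z‖ := by gcongr
            linarith
          · obtain ⟨z', hz', hρ⟩ := hc p hpf s ⟨z, hs⟩
            have hz'f := (hA.Esub p hpf s hz').1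
            have hle := hA.le1 p hpf z (hfc hz)
            have hcn : ‖c p * (‖ω p z‖ : ℂ)‖ = ‖ω p z‖ := by
              rw [norm_mul, hc1 p hpf]; simp
            refine ⟨ud (v p) (w p) (c p * (‖ω p z‖ : ℂ)), z', hz'f, h5 _ ?_, ?_, ?_, hρ _ (norm_nonneg _) hle⟩
            · refine (ud_sub _ _ _ _ (by rw [hcω p hpf]; exact hle) (by rw [hcn]; exact hle)).trans ?_
              rw [← mul_sub, norm_mul, hc1 p hpf, one_mul]
              have h6 := (hvwR p hpf).trans hR1
              calc _ ≤ 2 * 1 * e := by gcongr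
                _ = _ := by ring
            · refine (ud_norm _ _ _ (by rw [hcn]; exact hle)).trans ?_
              rw [hcn]
              calc _ ≤ R * 1 := mul_le_mul (hvwR p hpf) hle (norm_nonneg _) (hR0 p hpf)
                _ = R := mul_one _
            · exact hymod z' hz'f z hz (hA.Ediam p hpf s z' hz' z hs)

lemma rho_unif {N : ℕ} {X KK : Set (Cn N)} (hX : IsOpen X) {ρ : Cn N → ℝ} (hρ : ContinuousOn ρ X)
    (hK : IsCompact KK) (hKX : KK ⊆ X) (τ : ℝ) (hτ : 0 < τ) :
    ∃ τ1 > 0, ∀ a ∈ KK, ∀ b, ‖b - a‖ ≤ τ1 → |ρ b - ρ a| ≤ τ := by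
  have h := hK.uniformContinuousAt_of_continuousAt ρ
    (fun a ha => hρ.continuousAt (hX.mem_nhds (hKX ha))) (Metric.dist_mem_uniformity hτ)
  obtain ⟨r, hr, h⟩ := Metric.mem_uniformity_dist.1 h
  refine ⟨r / 2, by positivity, fun a ha b hb => ?_⟩
  have := @h a b (by rw [dist_comm, dist_eq_norm]; linarith) ha
  simp only [mem_setOf_eq] at this
  rw [dist_comm, Real.dist_eq] at this
  exact this.le

lemma ArcFam.mono {D : Set ℂ} {e κ κ' κs l : ℝ} {ω : ℂ → ℂ → ℂ} {E : ℂ → Bool → Set ℂ}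
    (h : ArcFam D e κ κs l ω E) (hl : 0 < l) (hκ : κ' ≤ κ) : ArcFam D e κ' κs l ω E :=
  { h with unif := fun p hp z hz z' hz' h1 h2 h3 => h.unif p hp z hz z' hz' h1 h2
            (h3.trans (mul_le_mul_of_nonneg_right hκ hl.le)) }

lemma unif_on {F : Type*} [NormedAddCommGroup F] {Z : Set ℂ} (hZ : IsCompact Z) {g : ℂ → F}
    (hg : ContinuousOn g Z) (t : ℝ) (ht : 0 < t) :
    ∃ β > 0, ∀ z ∈ Z, ∀ z' ∈ Z, ‖z - z'‖ < β → ‖g z - g z'‖ ≤ t := by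
  obtain ⟨β, hβ, h⟩ := Metric.uniformContinuousOn_iff.1 (hZ.uniformContinuousOn_of_continuous hg) t ht
  refine ⟨β, hβ, fun z hz z' hz' hzz => ?_⟩
  have := h z hz z' hz' (by rwa [dist_eq_norm])
  rw [dist_eq_norm] at this
  exact this.le

set_option maxHeartbeats 1600000 in
lemma rounds {N : ℕ} (X : Set (Cn N)) (hX : IsOpen X) (ρ : Cn N → ℝ)
    (hρ : ContDiffOn ℝ (⊤ : ℕ∞) ρ X) (K KK : Set (Cn N)) (hK : IsCompact K) (hKX : K ⊆ X)
    (hL : ∀ p ∈ K, TwoPosEigen ρ p) (hKK : IsCompact KK) (hKKX : KK ⊆ X) (rm : ℝ)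
    (hrm1 : rm ≤ 1) (hKrm : ∀ x ∈ K, ∀ y, ‖y - x‖ ≤ rm → y ∈ KK)
    (D : Set ℂ) (hDopen : IsOpen D) (hD : Bornology.IsBounded D) (hsb : SmoothlyBounded D)
    (Q : ℂ → ℂ) (hQ : Continuous Q) (hQ0 : ∀ z ∈ frontier D, Q z ≠ 0)
    (L : Finset (Fin 2 → ZMod 20)) :
    ∀ r0, 0 < r0 → r0 ≤ rm → ∃ δ > 0, ∀ T ⊆ frontier D, ∀ g0 : ℂ → Cn N,
      ContinuousOn g0 (closure D) → (∀ z ∈ frontier D, g0 z ∈ K) → ∀ d0 > 0, ∀ τ > 0,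
      ∃ κ > 0, ∃ l0 > 0, ∀ l, 0 < l → l < l0 → ∃ Φ : ℂ → Cn N, AnalyticOnNhd ℂ Φ (closure D) ∧
        (∀ z ∈ closure D, ‖Q z • Φ z‖ ≤ r0) ∧
        (∀ z ∈ frontier D, ∀ z' ∈ frontier D, ‖z - z'‖ ≤ κ * l → ‖Q z • Φ z - Q z' • Φ z'‖ ≤ τ) ∧
        (∀ z ∈ closure D, (∀ p ∈ T, d0 ≤ ‖z - p‖) → ‖Q z • Φ z‖ ≤ τ) ∧
        (∀ z ∈ frontier D, ρ (g0 z) - τ ≤ ρ (g0 z + Q z • Φ z)) ∧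
        (∀ z ∈ T, colour l z ∈ L → ρ (g0 z) + δ - τ ≤ ρ (g0 z + Q z • Φ z)) := by
  have hfc := frontier_subset_closure (s := D)
  have hcD : IsCompact (closure D) := hD.isCompact_closure
  obtain ⟨S, hS0, hS⟩ := lattice_sum
  obtain ⟨b1, hb1⟩ := hcD.exists_bound_of_continuousOn hQ.continuousOn
  obtain ⟨b2, hb2⟩ := (frontier_compact hD).exists_bound_of_continuousOn
    (f := fun p => (Q p)⁻¹) (hQ.continuousOn.inv₀ hQ0)
  set B := |b1| * |b2| with hBdef
  have hB0 : 0 ≤ B := by positivity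
  have hB : ∀ z ∈ closure D, ∀ p ∈ frontier D, ‖Q z * (Q p)⁻¹‖ ≤ B := by
    intro z hz p hp
    rw [norm_mul]
    exact mul_le_mul ((hb1 z hz).trans (le_abs_self _)) ((hb2 p hp).trans (le_abs_self _))
      (norm_nonneg _) (abs_nonneg _)
  induction L using Finset.induction_on with
  | empty =>
    intro r0 hr0 hr0m
    refine ⟨1, one_pos, ?_⟩
    intro T hT g0 hg0 hg0K d0 hd0 τ hτ
    refine ⟨1, one_pos, 1, one_pos, fun l hl hl1 => ⟨fun _ => 0, analyticOnNhd_const, ?_, ?_, ?_, ?_, ?_⟩⟩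
    · intro z _; simpa using hr0.le
    · intro z _ z' _ _; simpa using hτ.le
    · intro z _ _; simpa using hτ.le
    · intro z _; simpa using hτ.le
    · intro z _ h; simp at h
  | insert γ L hγ ih =>
    intro r0 hr0 hr0m
    obtain ⟨η, hη, δ1, hδ1, hdc⟩ := disc_compact X hX ρ hρ K hK hKX hL (r0 / 4) (by positivity)
    obtain ⟨δ2, hδ2, ih⟩ := ih (min (r0 / 2) (η / 2)) (by positivity)
      ((min_le_left _ _).trans (by linarith))
    refine ⟨min δ1 δ2, lt_min hδ1 hδ2, ?_⟩
    intro T hT g0 hg0 hg0K d0 hd0 τ hτ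
    obtain ⟨τ1, hτ1, hun⟩ := rho_unif hX hρ.continuousOn hKK hKKX (τ / 8) (by positivity)
    obtain ⟨κ1, hκ1, l1, hl1, ih⟩ := ih T hT g0 hg0 hg0K d0 hd0 (min (τ / 4) (τ1 / 4)) (by positivity)
    set C := 64 * B * S + 4 with hC
    have hC0 : 0 < C := by positivity
    obtain ⟨e, he, heC1, heC2, heC3⟩ : ∃ e > 0, C * e ≤ τ1 / 4 ∧ C * e ≤ τ / 8 ∧ C * e ≤ r0 / 4 := by
      refine ⟨min (min (τ1 / 4) (τ / 8)) (r0 / 4) / C, by positivity, ?_⟩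
      rw [mul_div_cancel₀ _ hC0.ne']
      exact ⟨(min_le_left _ _).trans (min_le_left _ _), (min_le_left _ _).trans (min_le_right _ _),
        min_le_right _ _⟩
    obtain ⟨κ2, hκ2, l2, hl2, harc⟩ := arcs D hDopen hD hsb e κ1 he hκ1
    obtain ⟨β, hβ, hgu⟩ := unif_on hcD hg0 (min (η / 2) (τ1 / 4)) (by positivity)
    obtain ⟨β', hβ', hQu⟩ := unif_on hcD hQ.continuousOn (e / (|b2| + 1)) (by positivity)
    refine ⟨min κ1 (min κ2 1), by positivity,
      min (min l1 l2) (min (min (β / (20 + κ1)) (β' / 20)) (d0 / 20)), by positivity, ?_⟩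
    intro l hl hll
    simp only [lt_min_iff] at hll
    obtain ⟨⟨hll1, hll2⟩, ⟨hllβ, hllβ'⟩, hlld⟩ := hll
    rw [lt_div_iff₀ (by positivity)] at hllβ hllβ' hlld
    have hβ20 : 20 * l < β := by nlinarith
    have hβκ : κ1 * l < β := by nlinarith
    obtain ⟨Φ, hΦan, hΦr, hΦm, hΦf, hΦρ, hΦT⟩ := ih l hl hll1
    obtain ⟨ω, E, hA⟩ := harc l hl hll2
    have hA' := hA.mono hl (κ' := min κ1 (min κ2 1)) ((min_le_right _ _).trans (min_le_left _ _))
    have hτ1' : min (τ / 4) (τ1 / 4) ≤ τ1 / 4 := min_le_right _ _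
    have hττ : min (τ / 4) (τ1 / 4) ≤ τ / 4 := min_le_left _ _
    have hΦr1 : ∀ z ∈ closure D, ‖Q z • Φ z‖ ≤ r0 / 2 := fun z hz => (hΦr z hz).trans (min_le_left _ _)
    have hΦr2 : ∀ z ∈ closure D, ‖Q z • Φ z‖ ≤ η / 2 := fun z hz => (hΦr z hz).trans (min_le_right _ _)
    set y : ℂ → Cn N := fun z => g0 z + Q z • Φ z with hy
    obtain ⟨Ψ, hΨan, hΨr, hΨm, hΨf, hΨp⟩ := round_fixed ρ D hD hS0 hS hl he
      ((min_le_right _ _).trans (min_le_right _ _)) hA' T hT γ Q B hB0 hB (by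
        intro z hz p hp hzp
        have h1 := hQu z hz p (hfc hp) (by linarith)
        have h2 : Q z * (Q p)⁻¹ - 1 = (Q z - Q p) * (Q p)⁻¹ := by
          rw [sub_mul, mul_inv_cancel₀ (hQ0 p hp)]
        rw [h2, norm_mul]
        calc _ ≤ e / (|b2| + 1) * (|b2| + 1) := by
              gcongr
              exact (hb2 p hp).trans (by linarith [le_abs_self b2])
          _ = e := by field_simp) (r0 / 4) (by linarith) η δ1 g0 (fun p hp => hdc (g0 p) (hg0K p hp)) y (by
        intro z hz p hp hzp
        have h1 := (hgu z (hfc hz) p (hfc hp) (by linarith)).trans (min_le_left _ _)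
        have h2 := hΦr2 z (hfc hz)
        have h3 : y z - g0 p = (g0 z - g0 p) + Q z • Φ z := by simp only [hy]; abel
        rw [h3]
        exact (norm_add_le _ _).trans (by linarith)) (τ1 / 2) (by positivity) (by
        intro z hz z' hz' hzz
        have h1 := (hgu z (hfc hz) z' (hfc hz') (by linarith)).trans (min_le_right _ _)
        have h2 := (hΦm z hz z' hz' hzz).trans hτ1'
        have h3 : y z - y z' = (g0 z - g0 z') + (Q z • Φ z - Q z' • Φ z') := by simp only [hy]; abel
        rw [h3]
        exact (norm_add_le _ _).trans (by linarith))
    rw [← hC] at hΨr hΨm hΨf hΨp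
    have hsum : ∀ z, Q z • (Φ z + Ψ z) = Q z • Φ z + Q z • Ψ z := fun z => smul_add _ _ _
    have hρs : ∀ z, g0 z + Q z • (Φ z + Ψ z) = y z + Q z • Ψ z := by
      intro z; simp only [hy]; rw [hsum, add_assoc]
    have hKy : ∀ z ∈ frontier D, ∀ u : Cn N, ‖u‖ ≤ r0 / 4 → y z + u ∈ KK := by
      intro z hz u hu
      apply hKrm (g0 z) (hg0K z hz)
      have h3 : y z + u - g0 z = Q z • Φ z + u := by simp only [hy]; abel
      rw [h3]
      have := hΦr1 z (hfc hz)
      exact (norm_add_le _ _).trans (by linarith)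
    have hcase1 : ∀ z ∈ frontier D, ∀ u : Cn N, ‖Q z • Ψ z - u‖ ≤ C * e → ‖u‖ ≤ r0 / 4 →
        ρ (y z) + δ1 ≤ ρ (y z + u) → ρ (y z) + δ1 - τ / 8 ≤ ρ (y z + Q z • Ψ z) := by
      intro z hz u h1 h2 h3
      have := hun (y z + u) (hKy z hz u h2) (y z + Q z • Ψ z) (by
        rw [add_sub_add_left_eq_sub]; linarith)
      have := (abs_le.1 this).1
      linarith
    have hcase2 : ∀ z ∈ frontier D, ∀ u : Cn N, ∀ z' ∈ frontier D, ‖Q z • Ψ z - u‖ ≤ C * e →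
        ‖u‖ ≤ r0 / 4 → ‖y z' - y z‖ ≤ τ1 / 2 → ρ (y z') ≤ ρ (y z' + u) →
        ρ (y z) - τ / 4 ≤ ρ (y z + Q z • Ψ z) := by
      intro z hz u z' hz' h1 h2 h3 h4
      have k1 := hun (y z' + u) (hKy z' hz' u h2) (y z + Q z • Ψ z) (by
        have : y z + Q z • Ψ z - (y z' + u) = (Q z • Ψ z - u) - (y z' - y z) := by abel
        rw [this]
        exact (norm_sub_le _ _).trans (by linarith))
      have hyz' : y z' ∈ KK := by
        have := hKy z' hz' 0 (by rw [norm_zero]; positivity)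
        rwa [add_zero] at this
      have k2 := hun (y z') hyz' (y z) (by rw [norm_sub_rev]; linarith)
      have := (abs_le.1 k1).1
      have := (abs_le.1 k2).2
      linarith
    refine ⟨fun z => Φ z + Ψ z, hΦan.add hΨan, ?_, ?_, ?_, ?_, ?_⟩
    · intro z hz
      rw [hsum]
      have h1 := hΦr1 z hz
      have h2 := hΨr z hz
      exact (norm_add_le _ _).trans (by linarith)
    · intro z hz z' hz' hzz
      rw [hsum, hsum, add_sub_add_comm]
      have h1 := hΦm z hz z' hz' (hzz.trans (by gcongr; exact min_le_left _ _))
      have h2 := hΨm z hz z' hz' hzz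
      exact (norm_add_le _ _).trans (by linarith)
    · intro z hz hfar
      rw [hsum]
      have h1 := hΦf z hz hfar
      have h2 := hΨf z hz (fun p hp => by have := hfar p hp; linarith)
      exact (norm_add_le _ _).trans (by linarith)
    · intro z hz
      rw [hρs]
      have h1 := hΦρ z hz
      rcases hΨp z hz with ⟨u, a1, a2, a3⟩ | ⟨-, u, z', hz', a1, a2, a3, a4⟩
      · have := hcase1 z hz u a1 a2 a3
        linarith
      · have := hcase2 z hz u z' hz' a1 a2 a3 a4
        linarith
    · intro z hzT hcol
      rw [hρs]
      have hz := hT hzT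
      have h1 := hΦρ z hz
      have m1 := min_le_left δ1 δ2
      have m2 := min_le_right δ1 δ2
      rcases Finset.mem_insert.1 hcol with hc | hc
      · rcases hΨp z hz with ⟨u, a1, a2, a3⟩ | ⟨hn, -⟩
        · have := hcase1 z hz u a1 a2 a3
          linarith
        · exact absurd ⟨hzT, hc⟩ hn
      · have h2 := hΦT z hzT hc
        rcases hΨp z hz with ⟨u, a1, a2, a3⟩ | ⟨-, u, z', hz', a1, a2, a3, a4⟩
        · have := hcase1 z hz u a1 a2 a3
          linarith
        · have := hcase2 z hz u z' hz' a1 a2 a3 a4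
          linarith

lemma step {N : ℕ} (X : Set (Cn N)) (hX : IsOpen X) (ρ : Cn N → ℝ)
    (hρ : ContDiffOn ℝ (⊤ : ℕ∞) ρ X) (K : Set (Cn N)) (hK : IsCompact K) (hKX : K ⊆ X)
    (hL : ∀ p ∈ K, TwoPosEigen ρ p)
    (D : Set ℂ) (hDopen : IsOpen D) (hD : Bornology.IsBounded D) (hsb : SmoothlyBounded D)
    (U : Set ℂ) (hUD : closure U ⊆ D)
    (Q : ℂ → ℂ) (hQ : Continuous Q) (hQ0 : ∀ z ∈ frontier D, Q z ≠ 0)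
    (c μ : ℝ) (hμ : 0 < μ) :
    ∃ δ > 0, ∀ e > 0, ∀ g : ℂ → Cn N, ContinuousOn g (closure D) → (∀ z ∈ closure D, g z ∈ X) →
      (∀ z ∈ frontier D, g z ∈ K) → ∃ Φ : ℂ → Cn N, AnalyticOnNhd ℂ Φ (closure D) ∧
        (∀ z ∈ closure D, ∀ s ∈ Icc (0:ℝ) 1, g z + s • (Q z • Φ z) ∈ X) ∧
        (∀ z ∈ frontier D, min (ρ (g z) + δ) c - e ≤ ρ (g z + Q z • Φ z)) ∧
        (∀ z ∈ frontier D, ρ (g z + Q z • Φ z) ≤ max (ρ (g z) + e) (c + μ)) ∧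
        (∀ z ∈ closure D, ρ (g z) - e ≤ ρ (g z + Q z • Φ z) ∨
          ∃ p ∈ frontier D, ρ (g p) - μ ≤ ρ (g z + Q z • Φ z)) ∧
        (∀ z ∈ closure U, ‖Q z • Φ z‖ < e) := by
  obtain ⟨rm0, hrm0, hrmX⟩ := hK.exists_cthickening_subset_open hX hKX
  obtain ⟨τ1, hτ1, hτK⟩ := rho_unif hX hρ.continuousOn hK hKX μ hμ
  set rm := min rm0 1 with hrm
  have hrmpos : 0 < rm := lt_min hrm0 one_pos
  have hKK : IsCompact (cthickening rm0 K) := hK.cthickening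
  have hKrm : ∀ x ∈ K, ∀ y, ‖y - x‖ ≤ rm0 → y ∈ cthickening rm0 K := by
    intro x hx y hy
    exact mem_cthickening_of_dist_le y x _ _ hx (by rwa [dist_eq_norm])
  set r0 := min rm τ1 / 2 with hr0
  have hr0p : 0 < r0 := by have := lt_min hrmpos hτ1; linarith
  have hr0a : 2 * r0 ≤ rm := by have := min_le_left rm τ1; linarith
  have hr0b : 2 * r0 ≤ τ1 := by have := min_le_right rm τ1; linarith
  have hrmle : rm ≤ rm0 := min_le_left _ _
  obtain ⟨δ, hδ, hR⟩ := rounds X hX ρ hρ K _ hK hKX hL hKK hrmX rm (min_le_right _ _)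
    (fun x hx y hy => hKrm x hx y (hy.trans hrmle)) D hDopen hD hsb Q hQ hQ0 Finset.univ r0 hr0p
    (by linarith)
  refine ⟨δ, hδ, ?_⟩
  intro e he g hg hgX hgK
  have hDc : IsCompact (closure D) := hD.isCompact_closure
  have hGc : IsCompact (g '' closure D) := hDc.image_of_continuousOn hg
  have hGX : g '' closure D ⊆ X := by rintro _ ⟨z, hz, rfl⟩; exact hgX z hz
  have hfr : frontier D ⊆ closure D := frontier_subset_closure
  obtain ⟨β, hβ, hβg⟩ := unif_on hDc hg r0 hr0p
  obtain ⟨τ2, hτ2, hτGa⟩ := rho_unif hX hρ.continuousOn hGc hGX e he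
  obtain ⟨τ3, hτ3, hτGb⟩ := hGc.exists_cthickening_subset_open hX hGX
  have hUc : IsCompact (closure U) :=
    hDc.of_isClosed_subset isClosed_closure (hUD.trans subset_closure)
  obtain ⟨dU, hdU, hdUD⟩ := hUc.exists_cthickening_subset_open hDopen hUD
  set d0 := min β dU with hd0
  have hd0p : 0 < d0 := lt_min hβ hdU
  set τ := min (e / 2) (min τ2 τ3) with hτ
  have hτp : 0 < τ := lt_min (by linarith) (lt_min hτ2 hτ3)
  have hτe : τ ≤ e / 2 := min_le_left _ _
  have hττ2 : τ ≤ τ2 := (min_le_right _ _).trans (min_le_left _ _)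
  have hττ3 : τ ≤ τ3 := (min_le_right _ _).trans (min_le_right _ _)
  set T := {z ∈ frontier D | ρ (g z) ≤ c} with hT
  obtain ⟨κ, hκ, l0, hl0, hl⟩ := hR T (fun z hz => hz.1) g hg hgK d0 hd0p τ hτp
  obtain ⟨Φ, hΦ, hΦr, -, hfar, hlow, hgain⟩ := hl (l0 / 2) (by linarith) (by linarith)
  have key : ∀ z ∈ closure D, ‖Q z • Φ z‖ ≤ τ ∨ ∃ p ∈ T, ‖g z - g p‖ ≤ r0 := by
    intro z hz
    by_cases h : ∀ p ∈ T, d0 ≤ ‖z - p‖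
    · exact Or.inl (hfar z hz h)
    · push Not at h
      obtain ⟨p, hp, hzp⟩ := h
      exact Or.inr ⟨p, hp, hβg z hz p (hfr hp.1) (hzp.trans_le (min_le_left _ _))⟩
  have near : ∀ z ∈ closure D, ∀ p, ‖g z - g p‖ ≤ r0 → ∀ s ∈ Icc (0:ℝ) 1,
      ‖g z + s • (Q z • Φ z) - g p‖ ≤ 2 * r0 := by
    intro z hz p hp s hs
    have h1 : ‖s • (Q z • Φ z)‖ ≤ r0 := by
      rw [norm_smul, Real.norm_of_nonneg hs.1]
      have := hΦr z hz
      nlinarith [hs.1, hs.2, norm_nonneg (Q z • Φ z)]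
    calc _ = ‖(g z - g p) + s • (Q z • Φ z)‖ := by congr 1; abel
      _ ≤ _ := norm_add_le _ _
      _ ≤ 2 * r0 := by linarith
  have near1 : ∀ z ∈ closure D, ∀ p ∈ T, ‖g z - g p‖ ≤ r0 →
      |ρ (g z + Q z • Φ z) - ρ (g p)| ≤ μ := by
    intro z hz p hp h
    refine hτK (g p) (hgK p hp.1) _ ?_
    have := near z hz p h 1 ⟨zero_le_one, le_rfl⟩
    rw [one_smul] at this
    linarith
  have far1 : ∀ z ∈ closure D, ‖Q z • Φ z‖ ≤ τ → |ρ (g z + Q z • Φ z) - ρ (g z)| ≤ e := by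
    intro z hz h
    refine hτGa (g z) ⟨z, hz, rfl⟩ _ ?_
    rw [add_sub_cancel_left]; linarith
  refine ⟨Φ, hΦ, ?_, ?_, ?_, ?_, ?_⟩
  · intro z hz s hs
    rcases key z hz with h | ⟨p, hp, h⟩
    · apply hτGb
      refine mem_cthickening_of_dist_le _ (g z) _ _ ⟨z, hz, rfl⟩ ?_
      rw [dist_eq_norm, add_sub_cancel_left, norm_smul, Real.norm_of_nonneg hs.1]
      nlinarith [hs.1, hs.2, norm_nonneg (Q z • Φ z)]
    · exact hrmX (hKrm (g p) (hgK p hp.1) _ (by have := near z hz p h s hs; linarith))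
  · intro z hz
    by_cases h : ρ (g z) ≤ c
    · have := hgain z ⟨hz, h⟩ (Finset.mem_univ _)
      have h2 := min_le_left (ρ (g z) + δ) c
      linarith
    · have := hlow z hz
      have h2 := min_le_right (ρ (g z) + δ) c
      linarith
  · intro z hz
    rcases key z (hfr hz) with h | ⟨p, hp, h⟩
    · have := (abs_le.1 (far1 z (hfr hz) h)).2
      exact le_max_of_le_left (by linarith)
    · have := (abs_le.1 (near1 z (hfr hz) p hp h)).2
      exact le_max_of_le_right (by have := hp.2; linarith)
  · intro z hz
    rcases key z hz with h | ⟨p, hp, h⟩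
    · have := (abs_le.1 (far1 z hz h)).1
      exact Or.inl (by linarith)
    · have := (abs_le.1 (near1 z hz p hp h)).1
      exact Or.inr ⟨p, hp.1, by linarith⟩
  · intro z hz
    have : ‖Q z • Φ z‖ ≤ τ := by
      apply hfar z (subset_closure (hUD hz))
      intro p hp
      by_contra h
      push Not at h
      have : p ∈ D := hdUD (mem_cthickening_of_dist_le p z _ _ hz (by
        rw [dist_comm, dist_eq_norm]; exact h.le.trans (min_le_right _ _)))
      have h3 := hp.1
      rw [hDopen.frontier_eq] at h3
      exact h3.2 this
    linarith

lemma homotopic_extend {N : ℕ} {X : Set (Cn N)} {S : Set ℂ} {f g u : ℂ → Cn N}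
    (h : HomotopicIn X S f g) (hu : ContinuousOn u S)
    (hX : ∀ z ∈ S, ∀ s ∈ Icc (0:ℝ) 1, g z + s • u z ∈ X) :
    HomotopicIn X S f (fun z => g z + u z) := by
  obtain ⟨H, hHc, hHX, hH0, hH1⟩ := h
  refine ⟨fun q => H (min (2 * q.1) 1, q.2) + (max (2 * q.1 - 1) 0) • u q.2, ?_, ?_, ?_, ?_⟩
  · apply ContinuousOn.add
    · refine hHc.comp (f := fun q : ℝ × ℂ => (min (2 * q.1) 1, q.2)) (by fun_prop) ?_
      rintro ⟨s, z⟩ ⟨hs, hz⟩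
      exact ⟨⟨le_min (by linarith [hs.1]) zero_le_one, min_le_right _ _⟩, hz⟩
    · have h1 : ContinuousOn (fun q : ℝ × ℂ => max (2 * q.1 - 1) 0) (Icc (0:ℝ) 1 ×ˢ S) := by
        fun_prop
      have h2 : ContinuousOn (fun q : ℝ × ℂ => u q.2) (Icc (0:ℝ) 1 ×ˢ S) :=
        hu.comp continuousOn_snd (fun q hq => hq.2)
      exact h1.smul h2
  · intro s hs z hz
    rcases le_total (2 * s) 1 with h | h
    · simp only [min_eq_left h, max_eq_right (show 2 * s - 1 ≤ 0 by linarith), zero_smul, add_zero]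
      exact hHX _ ⟨by linarith [hs.1], h⟩ z hz
    · simp only [min_eq_right h, max_eq_left (show 0 ≤ 2 * s - 1 by linarith), hH1 z hz]
      exact hX z hz _ ⟨by linarith, by linarith [hs.2]⟩
  · intro z hz
    simp [hH0 z hz]
  · intro z hz
    norm_num [hH1 z hz]

lemma iter {N : ℕ} (X : Set (Cn N)) (hX : IsOpen X) (ρ : Cn N → ℝ)
    (hρ : ContDiffOn ℝ (⊤ : ℕ∞) ρ X) (K : Set (Cn N)) (hK : IsCompact K) (hKX : K ⊆ X)
    (hL : ∀ p ∈ K, TwoPosEigen ρ p)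
    (D : Set ℂ) (hDopen : IsOpen D) (hD : Bornology.IsBounded D) (hsb : SmoothlyBounded D)
    (U : Set ℂ) (hUD : closure U ⊆ D)
    (Q : ℂ → ℂ) (hQ : Continuous Q) (hQ0 : ∀ z ∈ frontier D, Q z ≠ 0)
    (a b c μ M₂ M₃ ε : ℝ) (hμ : 0 < μ) (hε : 0 < ε) (hab : a + 2 * μ ≤ b) (hc3 : c + 2 * μ < M₃)
    (hc2 : M₂ < c) (hKdef : ∀ x ∈ X, a ≤ ρ x → ρ x ≤ M₃ → x ∈ K)
    (f : ℂ → Cn N) (hf : ContinuousOn f (closure D)) (hfX : ∀ z ∈ closure D, f z ∈ X)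
    (hfb : ∀ z ∈ closure D \ U, b ≤ ρ (f z)) (hfc : ∀ z ∈ frontier D, ρ (f z) ≤ c) :
    ∃ φ : ℂ → Cn N, AnalyticOnNhd ℂ φ (closure D) ∧
      (∀ z ∈ closure D, f z + Q z • φ z ∈ X) ∧
      HomotopicIn X (closure D) f (fun z => f z + Q z • φ z) ∧
      (∀ z ∈ frontier D, M₂ < ρ (f z + Q z • φ z) ∧ ρ (f z + Q z • φ z) < M₃) ∧
      (∀ z ∈ closure D \ U, a ≤ ρ (f z + Q z • φ z)) ∧
      (∀ z ∈ closure U, ‖Q z • φ z‖ < ε) := by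
  obtain ⟨δ, hδ, hstep⟩ := step X hX ρ hρ K hK hKX hL D hDopen hD hsb U hUD Q hQ hQ0 c μ hμ
  obtain ⟨S, hS⟩ := exists_nat_ge ((c - b) / δ)
  have hSδ : c ≤ b + S * δ := by
    rw [div_le_iff₀ hδ] at hS; linarith
  set m := min μ (min ε (c - M₂)) with hm
  have hmp : 0 < m := lt_min hμ (lt_min hε (by linarith))
  have hm1 : m ≤ μ := min_le_left _ _
  have hm2 : m ≤ ε := (min_le_right _ _).trans (min_le_left _ _)
  have hm3 : m ≤ c - M₂ := (min_le_right _ _).trans (min_le_right _ _)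
  set e := m / (S + 1) with he
  have hep : 0 < e := by positivity
  have hSe : S * e < m := by
    have : (S + 1) * e = m := by rw [he]; field_simp
    linarith
  have hfrU : ∀ z ∈ frontier D, z ∈ closure D \ U := by
    intro z hz
    refine ⟨frontier_subset_closure hz, fun h => ?_⟩
    rw [hDopen.frontier_eq] at hz
    exact hz.2 (hUD (subset_closure h))
  have main : ∀ s : ℕ, s ≤ S → ∃ φ : ℂ → Cn N, AnalyticOnNhd ℂ φ (closure D) ∧
      (∀ z ∈ closure D, f z + Q z • φ z ∈ X) ∧
      HomotopicIn X (closure D) f (fun z => f z + Q z • φ z) ∧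
      (∀ z ∈ frontier D, min (b + s * δ) c - s * e ≤ ρ (f z + Q z • φ z) ∧
        ρ (f z + Q z • φ z) ≤ c + μ + s * e) ∧
      (∀ z ∈ closure D \ U, b - μ - s * e ≤ ρ (f z + Q z • φ z)) ∧
      (∀ z ∈ closure U, ‖Q z • φ z‖ ≤ s * e) := by
    intro s
    induction s with
    | zero =>
      intro _
      refine ⟨fun _ => 0, analyticOnNhd_const, ?_, ?_, ?_, ?_, ?_⟩
      · simpa using hfX
      · refine ⟨fun q => f q.2, hf.comp continuousOn_snd (fun q hq => hq.2), ?_, ?_, ?_⟩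
        · intro s _ z hz; exact hfX z hz
        · simp
        · simp
      · intro z hz
        have h1 := hfb z (hfrU z hz)
        have h2 := hfc z hz
        simp only [smul_zero, add_zero, Nat.cast_zero, zero_mul, sub_zero]
        exact ⟨(min_le_left _ _).trans h1, by linarith⟩
      · intro z hz
        have h1 := hfb z hz
        simp only [smul_zero, add_zero, Nat.cast_zero, zero_mul, sub_zero]
        linarith
      · simp
    | succ s ih =>
      intro hsS
      obtain ⟨φ, hφ, h1, h2, h3, h4, h5⟩ := ih (by omega)
      have hse : s * e ≤ μ := by
        have : (s:ℝ) ≤ S := by exact_mod_cast (by omega : s ≤ S)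
        nlinarith
      have hsδ : (0:ℝ) ≤ s * δ := by positivity
      have hQφ : ContinuousOn (fun z => Q z • φ z) (closure D) :=
        hQ.continuousOn.smul hφ.continuousOn
      have hlowb : ∀ z ∈ frontier D, b - s * e ≤ ρ (f z + Q z • φ z) := by
        intro z hz
        have hh := (h3 z hz).1
        have h6 : b ≤ c := (hfb z (hfrU z hz)).trans (hfc z hz)
        have : b ≤ min (b + s * δ) c := le_min (by linarith) h6
        linarith
      obtain ⟨Φ, hΦ, g1, g2, g3, g4, g5⟩ := hstep e hep (fun z => f z + Q z • φ z) (hf.add hQφ) h1 (by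
        intro z hz
        have hh := h3 z hz
        have := hlowb z hz
        exact hKdef _ (h1 z (frontier_subset_closure hz)) (by linarith) (by linarith))
      have hQΦ : ContinuousOn (fun z => Q z • Φ z) (closure D) :=
        hQ.continuousOn.smul hΦ.continuousOn
      have heq : ∀ z, f z + Q z • (φ z + Φ z) = f z + Q z • φ z + Q z • Φ z := by
        intro z; rw [smul_add, add_assoc]
      refine ⟨fun z => φ z + Φ z, hφ.add hΦ, ?_, ?_, ?_, ?_, ?_⟩
      · intro z hz
        have := g1 z hz 1 ⟨zero_le_one, le_rfl⟩
        rw [one_smul] at this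
        rw [heq]; exact this
      · have := homotopic_extend h2 hQΦ g1
        simp only [heq]; exact this
      · intro z hz
        rw [heq]
        have k1 := g2 z hz
        have k2 := g3 z hz
        have k3 := h3 z hz
        have k4 : (0:ℝ) ≤ s * e := by positivity
        push_cast
        constructor
        · refine le_trans ?_ k1
          have : min (b + (s + 1) * δ) c - s * e ≤ min (ρ (f z + Q z • φ z) + δ) c := by
            apply le_min
            · have : min (b + (s + 1) * δ) c ≤ min (b + s * δ) c + δ := by
                rw [← min_add_add_right]
                exact min_le_min (by linarith) (by linarith)
              linarith
            · have := min_le_right (b + (s + 1) * δ) c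
              linarith
          linarith
        · refine k2.trans (max_le ?_ ?_)
          · linarith
          · linarith
      · intro z hz
        rw [heq]
        push_cast
        rcases g4 z hz.1 with h | ⟨p, hp, h⟩
        · have := h4 z hz
          linarith
        · have := hlowb p hp
          linarith
      · intro z hz
        have k1 := g5 z hz
        have k2 := h5 z hz
        rw [smul_add]
        have := norm_add_le (Q z • φ z) (Q z • Φ z)
        push_cast
        linarith
  obtain ⟨φ, hφ, h1, h2, h3, h4, h5⟩ := main S le_rfl
  refine ⟨φ, hφ, h1, h2, ?_, ?_, ?_⟩
  · intro z hz
    have := h3 z hz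
    rw [min_eq_right hSδ] at this
    constructor <;> linarith
  · intro z hz
    have := h4 z hz
    linarith
  · intro z hz
    have := h5 z hz
    linarith

lemma spray_slice_an {N n : ℕ} {D : Set ℂ} (hD : IsOpen D) {P : Set (Cn n)}
    {f : ℂ × Cn n → Cn N} (hf : DifferentiableOn ℂ f (D ×ˢ P)) {z : ℂ} (hz : z ∈ D) {t : Cn n}
    (ht : t ∈ P) : AnalyticAt ℂ (fun w => f (w, t)) z := by
  have : DifferentiableOn ℂ (fun w => f (w, t)) D :=
    hf.comp (f := fun w : ℂ => (w, t)) (by fun_prop) (fun w hw => ⟨hw, ht⟩)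
  exact this.analyticAt (hD.mem_nhds hz)

lemma slice_add {N n : ℕ} {D : Set ℂ} (hD : IsOpen D) {P : Set (Cn n)}
    {f : ℂ × Cn n → Cn N} (hf : DifferentiableOn ℂ f (D ×ˢ P)) {ψ : ℂ → Cn N}
    (hψ : AnalyticOnNhd ℂ ψ (closure D)) {z : ℂ} (hz : z ∈ D) {t : Cn n}
    (ht : t ∈ P) (j : ℕ) : iteratedDeriv j (fun w => f (w, t) + ψ w) z =
      iteratedDeriv j (fun w => f (w, t)) z + iteratedDeriv j ψ z :=
  iteratedDeriv_add (f := fun w => f (w, t)) (spray_slice_an hD hf hz ht).contDiffAt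
    (hψ z (subset_closure hz)).contDiffAt

lemma spray_add {N n : ℕ} {X : Set (Cn N)} (hX : IsOpen X) {D : Set ℂ} (hD : IsOpen D)
    (hDb : Bornology.IsBounded D) {P : Set (Cn n)} (hP : IsOpen P) (hP0 : (0 : Cn n) ∈ P)
    {σ : Set ℂ} (hσ : σ ⊆ D) {k : ℕ} {f : ℂ × Cn n → Cn N} (hf : SprayA2 X D P σ k f)
    {ψ : ℂ → Cn N} (hψ : AnalyticOnNhd ℂ ψ (closure D))
    (hψX : ∀ z ∈ closure D, f (z, 0) + ψ z ∈ X) :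
    ∃ P' : Set (Cn n), IsOpen P' ∧ (0 : Cn n) ∈ P' ∧ P' ⊆ P ∧
      SprayA2 X D P' σ k (fun q => f q + ψ q.1) := by
  obtain ⟨-, hc, hd, hi, hj, hs⟩ := hf
  have hgc : ContinuousOn (fun q : ℂ × Cn n => f q + ψ q.1) (closure D ×ˢ P) :=
    hc.add (hψ.continuousOn.comp continuousOn_fst (fun q hq => hq.1))
  obtain ⟨O, hO, hOeq⟩ := continuousOn_iff'.1 hgc X hX
  have hDc : IsCompact (closure D) := hDb.isCompact_closure
  have hsub : closure D ×ˢ ({0} : Set (Cn n)) ⊆ O := by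
    rintro ⟨z, t⟩ ⟨hz, ht⟩
    obtain rfl : t = 0 := ht
    have : (z, (0 : Cn n)) ∈ (fun q : ℂ × Cn n => f q + ψ q.1) ⁻¹' X ∩ closure D ×ˢ P :=
      ⟨hψX z hz, hz, hP0⟩
    rw [hOeq] at this
    exact this.1
  obtain ⟨u, v, hu, hv, hDu, h0v, huv⟩ := generalized_tube_lemma hDc isCompact_singleton hO hsub
  have hsub2 : closure D ×ˢ (v ∩ P) ⊆ closure D ×ˢ P := prod_mono le_rfl inter_subset_right
  refine ⟨v ∩ P, hv.inter hP, ⟨h0v rfl, hP0⟩, inter_subset_right, ?_, ?_, ?_, ?_, ?_, ?_⟩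
  · rintro ⟨z, t⟩ ⟨hz, ht⟩
    have : (z, t) ∈ O ∩ closure D ×ˢ P := ⟨huv ⟨hDu hz, ht.1⟩, hz, ht.2⟩
    rw [← hOeq] at this
    exact this.1
  · exact hgc.mono hsub2
  · have h1 : DifferentiableOn ℂ (fun q : ℂ × Cn n => ψ q.1) (D ×ˢ P) :=
      hψ.differentiableOn.comp differentiableOn_fst (fun q hq => subset_closure hq.1)
    exact (hd.add h1).mono (prod_mono le_rfl inter_subset_right)
  · intro i hi2
    obtain ⟨g, hg, hge⟩ := hi i hi2
    refine ⟨fun q => g q + iteratedDeriv i ψ q.1, ?_, ?_⟩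
    · have h1 : ContinuousOn (iteratedDeriv i ψ) (closure D) := by
        rw [iteratedDeriv_eq_iterate]
        exact (hψ.iterated_deriv i).continuousOn
      exact (hg.mono hsub2).add (h1.comp continuousOn_fst (fun q hq => hq.1))
    · rintro ⟨z, t⟩ ⟨hz, ht⟩
      have h1 := hge (show (z, t) ∈ D ×ˢ P from ⟨hz, ht.2⟩)
      have h2 := slice_add hD hd hψ hz ht.2 i
      simp only at h1 ⊢
      rw [h2, h1]
  · intro t ht z hz j hjk
    have h1 := slice_add hD hd hψ (hσ hz) ht.2 j
    have h2 := slice_add hD hd hψ (hσ hz) hP0 j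
    simp only
    rw [h1, h2, hj t ht.2 z hz j hjk]
  · intro z hz t ht
    simp only [fderiv_add_const]
    exact hs z hz t ht.2

lemma jet_zero {N : ℕ} {φ : ℂ → Cn N} {R : ℂ → ℂ} {s : ℂ} {k : ℕ} (hφ : AnalyticAt ℂ φ s)
    (hR : AnalyticAt ℂ R s) : ∀ j ≤ k,
    iteratedDeriv j (fun z => ((z - s) ^ (k + 1) * R z) • φ z) s = 0 := by
  intro j hj
  have han : AnalyticAt ℂ (fun z => ((z - s) ^ (k + 1) * R z) • φ z) s :=
    (((analyticAt_id.sub analyticAt_const).pow _).mul hR).smul hφ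
  have := (natCast_le_analyticOrderAt_iff_iteratedDeriv_eq_zero (n := k + 1) han).1
  apply this _ j (by omega)
  rw [natCast_le_analyticOrderAt han]
  refine ⟨fun z => R z • φ z, hR.smul hφ, ?_⟩
  filter_upwards with z
  rw [mul_smul]

/-- Lifting the boundary of the core of a spray from the level `(M₁,M₂)` of an
exhaustion function to the level `(M₂,M₃)`, keeping control on `Ū`, preserving
`k`-jets on the exceptional set, and not dropping below `M₁`. -/
theorem lifting_boundary_lemma
    (N n : ℕ) (hN : 2 ≤ N) (hn : 1 ≤ n)
    (X : Set (Cn N)) (hXopen : IsOpen X) (hXconn : IsConnected X)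
    (M₁ M₂ M₃ : ℝ) (h12 : M₁ < M₂) (h23 : M₂ < M₃)
    (ρ : Cn N → ℝ) (hρ : ContDiffOn ℝ (⊤ : ℕ∞) ρ X)
    (hexh : ∀ c : ℝ, IsCompact {x ∈ X | ρ x ≤ c})
    (hLevi : ∀ x ∈ X, M₁ < ρ x → TwoPosEigen ρ x)
    (D : Set ℂ) (hDopen : IsOpen D) (hDbdd : Bornology.IsBounded D)
    (hDconn : IsConnected D) (hDsb : SmoothlyBounded D)
    (P : Set (Cn n)) (hPopen : IsOpen P) (hP0 : (0 : Cn n) ∈ P)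
    (σ : Set ℂ) (hσfin : σ.Finite) (hσD : σ ⊆ D) (k : ℕ)
    (f : ℂ × Cn n → Cn N) (hf : SprayA2 X D P σ k f)
    (U : Set ℂ) (hUopen : IsOpen U) (hUD : closure U ⊆ D)
    (hform : ∀ z ∈ closure D \ U, M₁ < ρ (f (z, 0)) ∧ ρ (f (z, 0)) < M₂)
    (ε : ℝ) (hε : 0 < ε) :
    ∃ P' : Set (Cn n), IsOpen P' ∧ (0 : Cn n) ∈ P' ∧ P' ⊆ P ∧
      ∃ g : ℂ × Cn n → Cn N, SprayA2 X D P' σ k g ∧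
        (∀ z ∈ frontier D, M₂ < ρ (g (z, 0)) ∧ ρ (g (z, 0)) < M₃) ∧
        (∀ z ∈ closure D \ U, M₁ < ρ (g (z, 0))) ∧
        (∀ z ∈ closure U, ‖g (z, 0) - f (z, 0)‖ < ε) ∧
        (∀ z ∈ σ, ∀ j ≤ k,
          iteratedDeriv j (fun w => g (w, 0)) z = iteratedDeriv j (fun w => f (w, 0)) z) ∧
        HomotopicIn X (closure D) (fun w => f (w, 0)) (fun w => g (w, 0)) := by
  have hDc : IsCompact (closure D) := hDbdd.isCompact_closure
  have hfX : ∀ z ∈ closure D, f (z, 0) ∈ X := fun z hz => hf.1 _ ⟨hz, hP0⟩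
  have hfc : ContinuousOn (fun z => f (z, 0)) (closure D) :=
    hf.2.1.comp (f := fun z : ℂ => (z, (0 : Cn n))) (by fun_prop) (fun z hz => ⟨hz, hP0⟩)
  have hfrU : ∀ z ∈ frontier D, z ∈ closure D \ U := by
    intro z hz
    refine ⟨frontier_subset_closure hz, fun h => ?_⟩
    rw [hDopen.frontier_eq] at hz
    exact hz.2 (hUD (subset_closure h))
  obtain ⟨b, hb1, hb⟩ : ∃ b, M₁ < b ∧ ∀ z ∈ closure D \ U, b ≤ ρ (f (z, 0)) := by
    rcases (closure D \ U).eq_empty_or_nonempty with h | h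
    · exact ⟨M₁ + 1, by linarith, by simp [h]⟩
    · have hc : ContinuousOn (fun z => ρ (f (z, 0))) (closure D \ U) :=
        hρ.continuousOn.comp (hfc.mono diff_subset) (fun z hz => hfX z hz.1)
      obtain ⟨z0, hz0, hmin⟩ := (hDc.diff hUopen).exists_isMinOn h hc
      exact ⟨_, (hform z0 hz0).1, fun z hz => hmin hz⟩
  set μ := min ((b - M₁) / 4) ((M₃ - M₂) / 8) with hμ
  have hμ0 : 0 < μ := lt_min (by linarith) (by linarith)
  have hμ1 : μ ≤ (b - M₁) / 4 := min_le_left _ _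
  have hμ2 : μ ≤ (M₃ - M₂) / 8 := min_le_right _ _
  set a := M₁ + (b - M₁) / 4 with ha
  set c := (M₂ + M₃) / 2 with hc
  set K := {x ∈ X | a ≤ ρ x ∧ ρ x ≤ M₃} with hKdef
  have hKc : IsCompact K := by
    have h1 := hexh M₃
    have h2 : ContinuousOn ρ {x ∈ X | ρ x ≤ M₃} := hρ.continuousOn.mono (fun x hx => hx.1)
    have h3 := h2.preimage_isClosed_of_isClosed h1.isClosed (isClosed_Ici (a := a))
    refine h1.of_isClosed_subset (t := K) ?_ (fun x hx => ⟨hx.1, hx.2.2⟩)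
    convert h3 using 1
    ext x
    simp only [hKdef, mem_ofPred_eq, mem_inter_iff, mem_preimage, mem_Ici]
    tauto
  set R : ℂ → ℂ → ℂ := fun s z => ∏ s' ∈ hσfin.toFinset.erase s, (z - s') ^ (k + 1) with hR
  set Q : ℂ → ℂ := fun z => ∏ s ∈ hσfin.toFinset, (z - s) ^ (k + 1) with hQ
  have hQd : Differentiable ℂ Q := by rw [hQ]; fun_prop
  have hRd : ∀ s, Differentiable ℂ (R s) := by intro s; simp only [hR]; fun_prop
  obtain ⟨φ, hφ, h1, h2, h3, h4, h5⟩ := iter X hXopen ρ hρ K hKc (fun x hx => hx.1)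
    (fun p hp => hLevi p hp.1 (by have := hp.2.1; linarith)) D hDopen hDbdd hDsb U hUD Q
    hQd.continuous (by
      intro z hz
      rw [hQ]
      simp only
      rw [Finset.prod_ne_zero_iff]
      intro s hs
      apply pow_ne_zero
      rw [sub_ne_zero]
      rintro rfl
      rw [hDopen.frontier_eq] at hz
      exact hz.2 (hσD (hσfin.mem_toFinset.1 hs)))
    a b c μ M₂ M₃ ε hμ0 hε (by linarith) (by linarith) (by linarith)
    (fun x hx hx1 hx2 => ⟨hx, hx1, hx2⟩) (fun z => f (z, 0)) hfc hfX hb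
    (fun z hz => by have := (hform z (hfrU z hz)).2; linarith)
  have hψ : AnalyticOnNhd ℂ (fun z => Q z • φ z) (closure D) := fun z hz =>
    (hQd.analyticAt z).smul (hφ z hz)
  obtain ⟨P', hP'o, hP'0, hP'P, hspray⟩ := spray_add hXopen hDopen hDbdd hPopen hP0 hσD hf hψ h1
  refine ⟨P', hP'o, hP'0, hP'P, fun q => f q + Q q.1 • φ q.1, hspray, h3, ?_, ?_, ?_, h2⟩
  · intro z hz
    have := h4 z hz
    simp only
    linarith
  · intro z hz
    simpa using h5 z hz
  · intro z hz j hj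
    have e1 := slice_add hDopen hf.2.2.1 hψ (hσD hz) hP0 j
    have e2 : (fun w => Q w • φ w) = fun w => ((w - z) ^ (k + 1) * R z w) • φ w := by
      funext w
      rw [hQ, hR]
      simp only
      rw [Finset.mul_prod_erase _ (fun s => (w - s) ^ (k + 1)) (hσfin.mem_toFinset.2 hz)]
    have e3 := jet_zero (hφ z (subset_closure (hσD hz))) ((hRd z).analyticAt z) j hj
    simp only
    rw [e1, e2, e3, add_zero]
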